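/- arXiv:2102.05855 — 4 statements merged into one kernel-verified Lean document; each statement's English description precedes it below -/
import Mathlib

section
/- Let f, g : ℝ^d → ℝ be twice continuously differentiable functions that are both λ-strongly convex and β-smooth with 0 < λ ≤ β. Let 0 ≤ s ≤ η < 1/β. Then the map T_s : ℝ^d → ℝ^d defined by T_s(θ) = θ − ((η+s)/2)·∇f(θ) − ((η−s)/2)·∇g(θ) is (1 − ηλ)-Lipschitz, i.e., ‖T_s(w) − T_s(v)‖ ≤ (1 − ηλ)·‖w − v‖ for all w, v ∈ ℝ^d. -/
open scoped RealInnerProductSpace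

noncomputable section

variable {d : ℕ}

local notation "𝓔" => EuclideanSpace ℝ (Fin d)

section GradientStep

variable {E : Type*} [NormedAddCommGroup E] [InnerProductSpace ℝ E]

/-- The descent lemma: a function with `β`-Lipschitz gradient lies below its quadratic models. -/
theorem le_quadratic_of_gradient_lipschitz [CompleteSpace E] {f : E → ℝ}
    (hf : Differentiable ℝ f) {β : ℝ}
    (hsm : ∀ x y : E, ‖gradient f x - gradient f y‖ ≤ β * ‖x - y‖) (x y : E) :
    f y ≤ f x + ⟪gradient f x, y - x⟫ + β / 2 * ‖y - x‖ ^ 2 := by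
  set u := y - x with hu
  let q : ℝ → ℝ := fun t => f (x + t • u) - t * ⟪gradient f x, u⟫ - β / 2 * ‖u‖ ^ 2 * t ^ 2
  have hq : ∀ t, HasDerivAt q
      (⟪gradient f (x + t • u), u⟫ - ⟪gradient f x, u⟫ - β * ‖u‖ ^ 2 * t) t := by
    intro t
    have hline : HasDerivAt (fun t : ℝ => x + t • u) u t := by
      simpa using ((hasDerivAt_id t).smul_const u).const_add x
    have hcomp : HasDerivAt (fun t : ℝ => f (x + t • u)) ⟪gradient f (x + t • u), u⟫ t := by
      simpa [Function.comp_def] using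
        (hf (x + t • u)).hasGradientAt.hasFDerivAt.comp_hasDerivAt t hline
    have hlin : HasDerivAt (fun t : ℝ => t * ⟪gradient f x, u⟫) ⟪gradient f x, u⟫ t := by
      simpa using (hasDerivAt_id t).mul_const ⟪gradient f x, u⟫
    have hquad := (hasDerivAt_pow 2 t).const_mul (β / 2 * ‖u‖ ^ 2)
    refine ((hcomp.sub hlin).sub hquad).congr_deriv ?_
    push_cast
    ring
  have hanti : AntitoneOn q (Set.Ici 0) := by
    refine antitoneOn_of_deriv_nonpos (convex_Ici 0)
      (fun t _ => (hq t).continuousAt.continuousWithinAt)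
      (fun t _ => (hq t).differentiableAt.differentiableWithinAt) fun t ht => ?_
    rw [interior_Ici, Set.mem_Ioi] at ht
    rw [(hq t).deriv, ← inner_sub_left]
    have hgrad := hsm (x + t • u) x
    rw [add_sub_cancel_left, norm_smul, Real.norm_of_nonneg ht.le] at hgrad
    have hinner := real_inner_le_norm (gradient f (x + t • u) - gradient f x) u
    nlinarith [mul_le_mul_of_nonneg_right hgrad (norm_nonneg u)]
  have h01 := hanti (Set.mem_Ici.2 le_rfl) (Set.mem_Ici.2 zero_le_one) zero_le_one
  have hxu : x + u = y := by simp [hu]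
  simp only [q, one_smul, zero_smul, hxu, add_zero] at h01
  linarith

/-- Quadratic lower and upper models of `f` with slopes `G` improve the strong convexity
inequality by a multiple of `‖G y - G x - lam • (y - x)‖ ^ 2`. -/
theorem improved_strong_convexity {f : E → ℝ} {G : E → E} {lam β : ℝ}
    (hlow : ∀ x y : E, f x + ⟪G x, y - x⟫ + lam / 2 * ‖y - x‖ ^ 2 ≤ f y)
    (hup : ∀ x y : E, f y ≤ f x + ⟪G x, y - x⟫ + β / 2 * ‖y - x‖ ^ 2) (t : ℝ) (x y : E) :
    f x + ⟪G x, y - x⟫ + lam / 2 * ‖y - x‖ ^ 2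
      + (t - (β - lam) / 2 * t ^ 2) * ‖G y - G x - lam • (y - x)‖ ^ 2 ≤ f y := by
  set u := y - x with hu
  set e := G y - G x - lam • u with he
  have h₁ := hlow x (y - t • e)
  have h₂ := hup y (y - t • e)
  have hzx : y - t • e - x = u - t • e := by rw [hu]; abel
  have hzy : y - t • e - y = -(t • e) := by abel
  have hGy : G y = G x + lam • u + e := by rw [he]; abel
  rw [hzx, norm_sub_sq_real, norm_smul, mul_pow, Real.norm_eq_abs, sq_abs] at h₁
  rw [hzy, norm_neg, norm_smul, mul_pow, Real.norm_eq_abs, sq_abs, hGy] at h₂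
  simp only [inner_sub_right, inner_neg_right, inner_add_left, real_inner_smul_left,
    real_inner_smul_right, real_inner_self_eq_norm_sq] at h₁ h₂
  linarith

/-- A gradient step of size `η < 1 / β` is `(1 - η * lam)`-Lipschitz. -/
theorem norm_gradient_step_sub_le [CompleteSpace E] {f : E → ℝ} (hf : Differentiable ℝ f)
    {lam β η : ℝ} (hlam : 0 < lam) (hlamβ : lam ≤ β)
    (hsc : ∀ x y : E, f y ≥ f x + ⟪gradient f x, y - x⟫ + lam / 2 * ‖y - x‖ ^ 2)
    (hsm : ∀ x y : E, ‖gradient f x - gradient f y‖ ≤ β * ‖x - y‖)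
    (hη : 0 ≤ η) (hηβ : η < 1 / β) (w v : E) :
    ‖(w - v) - η • (gradient f w - gradient f v)‖ ≤ (1 - η * lam) * ‖w - v‖ := by
  have hηβ' : η * β < 1 := (lt_div_iff₀ (hlam.trans_le hlamβ)).1 hηβ
  have hpos : 0 < 1 - η * lam := by nlinarith
  have hup := le_quadratic_of_gradient_lipschitz hf hsm
  set t := η / (1 - η * lam) with ht
  have ht0 : 0 ≤ t := div_nonneg hη hpos.le
  have hηt : (1 - η * lam) * t = η := mul_div_cancel₀ η hpos.ne'
  have htβ : (β - lam) * t ≤ 1 := by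
    rw [ht, ← mul_div_assoc, div_le_one hpos]
    linarith
  have h₁ := improved_strong_convexity hsc hup t v w
  have h₂ := improved_strong_convexity hsc hup t w v
  set u := w - v with hu
  set D := gradient f w - gradient f v with hD
  have hvw : v - w = -u := by rw [hu]; abel
  set e := D - lam • u with he
  have hswap : gradient f v - gradient f w - lam • -u = -e := by rw [he, hD, smul_neg]; abel
  have hw : gradient f w = gradient f v + lam • u + e := by rw [he, hD]; abel
  rw [hvw, hswap, norm_neg, norm_neg, hw] at h₂
  simp only [inner_neg_right, inner_add_left, real_inner_smul_left,
    real_inner_self_eq_norm_sq] at h₂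
  have hcoer : t * ‖e‖ ^ 2 ≤ ⟪e, u⟫ := by
    nlinarith [mul_le_mul_of_nonneg_right htβ (mul_nonneg ht0 (sq_nonneg ‖e‖))]
  have hstep : u - η • D = (1 - η * lam) • u - η • e := by rw [he]; module
  refine (sq_le_sq₀ (norm_nonneg _) (mul_nonneg hpos.le (norm_nonneg u))).1 ?_
  rw [hstep, norm_sub_sq_real, norm_smul, norm_smul, mul_pow, mul_pow, mul_pow,
    Real.norm_eq_abs, Real.norm_eq_abs, sq_abs, sq_abs, real_inner_smul_left,
    real_inner_smul_right, real_inner_comm]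
  have hmul := mul_le_mul_of_nonneg_left hcoer (mul_nonneg hη hpos.le)
  have hsq : η * (1 - η * lam) * (t * ‖e‖ ^ 2) = η ^ 2 * ‖e‖ ^ 2 := by
    linear_combination η * ‖e‖ ^ 2 * hηt
  nlinarith [mul_nonneg (sq_nonneg η) (sq_nonneg ‖e‖)]

end GradientStep

/-- Lipschitzness of the interpolated gradient map.
If `f` and `g` are twice continuously differentiable, `λ`-strongly convex and `β`-smooth with
`0 < λ ≤ β`, and `0 ≤ s ≤ η < 1/β`, then
`T_s(θ) = θ − ((η+s)/2)∇f(θ) − ((η−s)/2)∇g(θ)` is `(1 − ηλ)`-Lipschitz. -/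
theorem interpolated_gradient_map_lipschitz
    (f g : 𝓔 → ℝ) (hf : ContDiff ℝ 2 f) (hg : ContDiff ℝ 2 g)
    (lam β s η : ℝ) (hlam : 0 < lam) (hlamβ : lam ≤ β)
    -- `λ`-strong convexity
    (hfsc : ∀ θ θ' : 𝓔, f θ' ≥ f θ + ⟪gradient f θ, θ' - θ⟫ + lam / 2 * ‖θ' - θ‖ ^ 2)
    (hgsc : ∀ θ θ' : 𝓔, g θ' ≥ g θ + ⟪gradient g θ, θ' - θ⟫ + lam / 2 * ‖θ' - θ‖ ^ 2)
    -- `β`-smoothness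
    (hfsm : ∀ θ θ' : 𝓔, ‖gradient f θ - gradient f θ'‖ ≤ β * ‖θ - θ'‖)
    (hgsm : ∀ θ θ' : 𝓔, ‖gradient g θ - gradient g θ'‖ ≤ β * ‖θ - θ'‖)
    (hs : 0 ≤ s) (hsη : s ≤ η) (hηβ : η < 1 / β) :
    ∀ w v : 𝓔,
      ‖(w - ((η + s) / 2) • gradient f w - ((η - s) / 2) • gradient g w)
          - (v - ((η + s) / 2) • gradient f v - ((η - s) / 2) • gradient g v)‖
        ≤ (1 - η * lam) * ‖w - v‖ := by
  intro w v
  have hη : 0 ≤ η := hs.trans hsη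
  rcases hη.eq_or_lt with rfl | hη_pos
  · obtain rfl : s = 0 := le_antisymm hsη hs
    simp
  have hFw := norm_gradient_step_sub_le (hf.differentiable two_ne_zero) hlam hlamβ hfsc hfsm
    hη hηβ w v
  have hGw := norm_gradient_step_sub_le (hg.differentiable two_ne_zero) hlam hlamβ hgsc hgsm
    hη hηβ w v
  set a := (η + s) / (2 * η) with ha
  set b := (η - s) / (2 * η) with hb
  have ha0 : 0 ≤ a := by positivity
  have hb0 : 0 ≤ b := div_nonneg (sub_nonneg.2 hsη) (by positivity)
  have hab : a + b = 1 := by rw [ha, hb]; field_simp; ring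
  have haη : (η + s) / 2 = a * η := by rw [ha]; field_simp
  have hbη : (η - s) / 2 = b * η := by rw [hb]; field_simp
  have hsplit : (w - ((η + s) / 2) • gradient f w - ((η - s) / 2) • gradient g w)
      - (v - ((η + s) / 2) • gradient f v - ((η - s) / 2) • gradient g v)
      = a • ((w - v) - η • (gradient f w - gradient f v))
        + b • ((w - v) - η • (gradient g w - gradient g v)) := by
    rw [haη, hbη, eq_sub_of_add_eq' hab]
    module
  rw [hsplit]
  exact mem_closedBall_zero_iff.1 (convex_closedBall (0 : 𝓔) _
    (mem_closedBall_zero_iff.2 hFw) (mem_closedBall_zero_iff.2 hGw) ha0 hb0 hab)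

end
end

section
/- Let ℓ(θ;x) be a loss function that is λ-strongly convex and β-smooth in θ on a closed convex set C ⊆ ℝ^d, whose total gradient g(θ;D) = ∑_{i=1}^n ∇ℓ(θ;x_i) has finite sensitivity S_g over neighboring datasets. Let 0 < η < 1/β, σ > 0, K ∈ ℕ, α > 1. Let D and D' be any neighboring datasets of size n, and run the noisy gradient descent chains θ_{k+1} = Π_C(θ_k − (η/n)·g(θ_k;D) + √(2ησ²)·Z_k) and θ'_{k+1} = Π_C(θ'_k − (η/n)·g(θ'_k;D') + √(2ησ²)·Z_k) from the common initialization θ₀ = θ'₀ = Π_C(W), W ∼ N(0, (2σ²/λ)·I_d), where Π_C is the nearest-point projection onto C and Z_k are i.i.d. standard Gaussians on ℝ^d. Then the α-Rényi divergence between the laws of θ_K and θ'_K satisfies R_α(θ_K‖θ'_K) ≤ (α·S_g²/(λ·σ²·n²))·(1 − e^{−λ·η·K/2}); that is, noisy GD satisfies (α, ε)-Rényi differential privacy with ε = (α S_g²/(λσ²n²))(1 − e^{−ληK/2}). -/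
open MeasureTheory ProbabilityTheory Real
open scoped RealInnerProductSpace

noncomputable section

variable {d : ℕ}

local notation "𝓔" => EuclideanSpace ℝ (Fin d)

/-- The standard Gaussian measure `N(0, I_d)` on `ℝ^d`. -/
def stdGaussian (d : ℕ) : Measure (EuclideanSpace ℝ (Fin d)) :=
  Measure.map (⇑(EuclideanSpace.equiv (Fin d) ℝ).symm)
    (Measure.pi fun _ : Fin d => gaussianReal 0 1)

/-- The `α`-Rényi divergence between two measures,
`R_α(ν‖ν') = (α−1)⁻¹ log ∫ (dν/dν')^α dν'`. -/
def renyiDiv {d : ℕ} (α : ℝ) (ν ν' : Measure (EuclideanSpace ℝ (Fin d))) : ℝ :=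
  (α - 1)⁻¹ * Real.log (∫ θ, (ν.rnDeriv ν' θ).toReal ^ α ∂ν')

/-- Two datasets of size `n` are neighboring if they differ in exactly one record. -/
def Neighboring {X : Type*} {n : ℕ} (A B : Fin n → X) : Prop :=
  ∃ i₀ : Fin n, ∀ i : Fin n, i ≠ i₀ → A i = B i

/-- The dual (Hölder) form of a bound on the Rényi divergence of order conjugate to `q`. -/
def HolderDominated {Ω : Type*} [MeasurableSpace Ω] (q : ℝ) (M : ENNReal) (μ ν : Measure Ω) :
    Prop :=
  ∀ f : Ω → ENNReal, Measurable f → ∫⁻ x, f x ∂μ ≤ M * (∫⁻ x, f x ^ q ∂ν) ^ (1 / q)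

lemma HolderDominated.map {Ω Ω' : Type*} [MeasurableSpace Ω] [MeasurableSpace Ω'] {q : ℝ}
    {M : ENNReal} {μ ν : Measure Ω} (h : HolderDominated q M μ ν) {φ : Ω → Ω'}
    (hφ : Measurable φ) : HolderDominated q M (μ.map φ) (ν.map φ) := by
  intro f hf
  rw [lintegral_map hf hφ, lintegral_map (hf.pow_const q) hφ]
  exact h _ (hf.comp hφ)

lemma HolderDominated.refl {Ω : Type*} [MeasurableSpace Ω] {p q : ℝ} (hpq : p.HolderConjugate q)
    (μ : Measure Ω) [IsProbabilityMeasure μ] : HolderDominated q 1 μ μ := by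
  intro f hf
  have := ENNReal.lintegral_mul_le_Lp_mul_Lq μ hpq.symm hf.aemeasurable
    (aemeasurable_const (b := (1 : ENNReal)))
  simpa using this

lemma HolderDominated.map_prod {Ω Ω' Z : Type*} [MeasurableSpace Ω] [MeasurableSpace Ω']
    [MeasurableSpace Z] {q : ℝ} (hq : 0 < q) {M M' : ENNReal} {P Q : Measure Ω} {γ : Measure Z}
    [SFinite P] [SFinite Q] [SFinite γ] (h : HolderDominated q M P Q) {φ ψ : Ω × Z → Ω'}
    (hφ : Measurable φ) (hψ : Measurable ψ)
    (hstep : ∀ᵐ x ∂P, ∀ f : Ω' → ENNReal, Measurable f →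
      ∫⁻ z, f (φ (x, z)) ∂γ ≤ M' * (∫⁻ z, f (ψ (x, z)) ^ q ∂γ) ^ (1 / q)) :
    HolderDominated q (M' * M) ((P.prod γ).map φ) ((Q.prod γ).map ψ) := by
  intro f hf
  have hm : Measurable fun a => f (ψ a) ^ q := (hf.comp hψ).pow_const q
  have hm' : Measurable fun x => ∫⁻ z, f (ψ (x, z)) ^ q ∂γ := hm.lintegral_prod_right'
  have hm₁ : Measurable fun a => f (φ a) := hf.comp hφ
  rw [lintegral_map hf hφ, lintegral_map (hf.pow_const q) hψ,
    lintegral_prod _ hm₁.aemeasurable, lintegral_prod _ hm.aemeasurable]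
  calc ∫⁻ x, ∫⁻ z, f (φ (x, z)) ∂γ ∂P
      ≤ ∫⁻ x, M' * (∫⁻ z, f (ψ (x, z)) ^ q ∂γ) ^ (1 / q) ∂P :=
        lintegral_mono_ae (hstep.mono fun x hx => hx f hf)
    _ = M' * ∫⁻ x, (∫⁻ z, f (ψ (x, z)) ^ q ∂γ) ^ (1 / q) ∂P :=
        lintegral_const_mul _ (hm'.pow_const _)
    _ ≤ M' * (M * (∫⁻ x, ((∫⁻ z, f (ψ (x, z)) ^ q ∂γ) ^ (1 / q)) ^ q ∂Q) ^ (1 / q)) := by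
        gcongr
        exact h _ (hm'.pow_const _)
    _ = M' * M * (∫⁻ x, ∫⁻ z, f (ψ (x, z)) ^ q ∂γ ∂Q) ^ (1 / q) := by
        simp_rw [← ENNReal.rpow_mul, one_div_mul_cancel hq.ne', ENNReal.rpow_one, mul_assoc]

lemma HolderDominated.lintegral_rnDeriv_rpow_le {Ω : Type*} [MeasurableSpace Ω] {p q : ℝ}
    (hpq : p.HolderConjugate q) {M : ENNReal} {μ ν : Measure Ω} [IsFiniteMeasure ν]
    (h : HolderDominated q M μ ν) : ∫⁻ x, μ.rnDeriv ν x ^ p ∂ν ≤ M ^ p := by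
  set r := μ.rnDeriv ν with hr
  have hrm : Measurable r := Measure.measurable_rnDeriv μ ν
  have hp := hpq.pos
  have hp1 : 0 < p - 1 := by linarith [hpq.lt]
  have hq := hpq.symm.pos
  have htrunc : ∀ N : ℕ, ∫⁻ x, (min (r x) N) ^ p ∂ν ≤ M ^ p := by
    intro N
    have hmm : Measurable fun x => min (r x) (N : ENNReal) := hrm.min measurable_const
    set I := ∫⁻ x, (min (r x) (N : ENNReal)) ^ p ∂ν with hI
    have hIfin : I ≠ ⊤ := by
      refine ne_top_of_le_ne_top ?_ (lintegral_mono (g := fun _ => (N : ENNReal) ^ p) fun x => ?_)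
      · rw [lintegral_const]
        exact ENNReal.mul_ne_top (ENNReal.rpow_ne_top_of_nonneg hp.le (ENNReal.natCast_ne_top N))
          (measure_ne_top _ _)
      · exact ENNReal.rpow_le_rpow (min_le_right _ _) hp.le
    have h1 : I ≤ M * I ^ (1 / q) := by
      calc I ≤ ∫⁻ x, r x * (min (r x) (N : ENNReal)) ^ (p - 1) ∂ν := by
            refine lintegral_mono fun x => ?_
            calc (min (r x) (N : ENNReal)) ^ p
                = (min (r x) (N : ENNReal)) ^ (1 + (p - 1)) := by congr 1; ring
              _ = (min (r x) (N : ENNReal)) * (min (r x) (N : ENNReal)) ^ (p - 1) := by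
                  rw [ENNReal.rpow_add_of_nonneg _ _ zero_le_one hp1.le, ENNReal.rpow_one]
              _ ≤ _ := by gcongr; exact min_le_left _ _
        _ = ∫⁻ x, (min (r x) (N : ENNReal)) ^ (p - 1) ∂(ν.withDensity r) := by
            rw [lintegral_withDensity_eq_lintegral_mul _ hrm (hmm.pow_const _)]
            rfl
        _ ≤ ∫⁻ x, (min (r x) (N : ENNReal)) ^ (p - 1) ∂μ :=
            lintegral_mono' (Measure.withDensity_rnDeriv_le μ ν) le_rfl
        _ ≤ M * (∫⁻ x, ((min (r x) (N : ENNReal)) ^ (p - 1)) ^ q ∂ν) ^ (1 / q) :=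
            h _ (hmm.pow_const _)
        _ = M * I ^ (1 / q) := by
            simp_rw [← ENNReal.rpow_mul, hpq.sub_one_mul_conj, hI]
    rcases eq_or_ne I 0 with h0 | h0
    · rw [h0]; exact zero_le
    have h2 : I ^ (1 / p) ≤ M := by
      have hsum : 1 / p + 1 / q = 1 := by simpa using hpq.inv_add_inv_eq_one
      have h3 : I ^ (1 / p) * I ^ (1 / q) ≤ M * I ^ (1 / q) := by
        rw [← ENNReal.rpow_add _ _ h0 hIfin, hsum, ENNReal.rpow_one]
        exact h1
      refine (ENNReal.mul_le_mul_iff_left ?_ ?_).1 h3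
      · exact (ENNReal.rpow_pos (pos_iff_ne_zero.2 h0) hIfin).ne'
      · exact ENNReal.rpow_ne_top_of_nonneg (by positivity) hIfin
    calc I = (I ^ (1 / p)) ^ p := by
          rw [← ENNReal.rpow_mul, one_div_mul_cancel hp.ne', ENNReal.rpow_one]
      _ ≤ M ^ p := ENNReal.rpow_le_rpow h2 hp.le
  have hsup : ∀ x, r x ^ p = ⨆ N : ℕ, (min (r x) (N : ENNReal)) ^ p := by
    intro x
    have h1 : r x = ⨆ N : ℕ, min (r x) (N : ENNReal) := by
      rw [← inf_iSup_eq, ENNReal.iSup_natCast, inf_top_eq]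
    conv_lhs => rw [h1]
    exact (ENNReal.orderIsoRpow p hp).map_iSup _
  simp_rw [hsup]
  rw [lintegral_iSup]
  · exact iSup_le htrunc
  · exact fun N => (hrm.min measurable_const).pow_const p
  · intro N N' hN x
    refine ENNReal.rpow_le_rpow (min_le_min le_rfl ?_) hp.le
    exact_mod_cast hN

lemma renyiDiv_le_of_holderDominated {α q B : ℝ} (hpq : α.HolderConjugate q)
    {μ ν : Measure (EuclideanSpace ℝ (Fin d))} [IsFiniteMeasure ν] (hB : 0 ≤ B)
    (h : HolderDominated q (ENNReal.ofReal (Real.exp ((α - 1) * B))) μ ν) :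
    renyiDiv α μ ν ≤ α * B := by
  have hα := hpq.lt
  have hα0 := hpq.pos
  have hα1 : 0 < α - 1 := by linarith
  have h1 := h.lintegral_rnDeriv_rpow_le hpq
  rw [ENNReal.ofReal_rpow_of_pos (Real.exp_pos _), ← Real.exp_mul] at h1
  have h2 : ∫ θ, (μ.rnDeriv ν θ).toReal ^ α ∂ν ≤ Real.exp ((α - 1) * B * α) := by
    rw [integral_eq_lintegral_of_nonneg_ae
      (Filter.Eventually.of_forall fun x => Real.rpow_nonneg ENNReal.toReal_nonneg _)
      ((Measure.measurable_rnDeriv μ ν).ennreal_toReal.pow_const α).aestronglyMeasurable]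
    refine ENNReal.toReal_le_of_le_ofReal (Real.exp_pos _).le (le_trans ?_ h1)
    refine lintegral_mono fun x => ?_
    rw [ENNReal.toReal_rpow]
    exact ENNReal.ofReal_toReal_le
  have h3 : Real.log (∫ θ, (μ.rnDeriv ν θ).toReal ^ α ∂ν) ≤ (α - 1) * B * α := by
    have h0 : 0 ≤ ∫ θ, (μ.rnDeriv ν θ).toReal ^ α ∂ν :=
      integral_nonneg fun x => Real.rpow_nonneg ENNReal.toReal_nonneg _
    rcases h0.eq_or_lt with h0 | h0
    · rw [← h0, Real.log_zero]
      positivity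
    · exact (Real.log_le_log h0 h2).trans (Real.log_exp _).le
  unfold renyiDiv
  calc (α - 1)⁻¹ * Real.log (∫ θ, (μ.rnDeriv ν θ).toReal ^ α ∂ν)
      ≤ (α - 1)⁻¹ * ((α - 1) * B * α) := by gcongr
    _ = α * B := by field_simp

lemma gaussianReal_withDensity_exp (a : ℝ) :
    (gaussianReal 0 1).withDensity (fun x => ENNReal.ofReal (Real.exp (a * x - a ^ 2 / 2)))
      = gaussianReal a 1 := by
  rw [gaussianReal_of_var_ne_zero 0 one_ne_zero, gaussianReal_of_var_ne_zero a one_ne_zero,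
    ← withDensity_mul _ (measurable_gaussianPDF 0 1) (by fun_prop)]
  congr 1
  ext x
  simp only [Pi.mul_apply, gaussianPDF]
  rw [← ENNReal.ofReal_mul (gaussianPDFReal_nonneg _ _ _)]
  congr 1
  simp only [gaussianPDFReal, mul_assoc, ← Real.exp_add]
  congr 2
  push_cast
  ring

lemma pi_gaussianReal_withDensity_exp (a : Fin d → ℝ) :
    (Measure.pi fun _ : Fin d => gaussianReal 0 1).withDensity
        (fun x => ENNReal.ofReal (Real.exp (∑ i, (a i * x i - a i ^ 2 / 2))))
      = Measure.pi fun i => gaussianReal (a i) 1 := by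
  symm
  refine Measure.pi_eq fun s hs => ?_
  rw [withDensity_apply _ (MeasurableSet.univ_pi hs),
    ← lintegral_indicator (MeasurableSet.univ_pi hs)]
  set w : Fin d → ℝ → ENNReal := fun i => (s i).indicator
    fun x => ENNReal.ofReal (Real.exp (a i * x - a i ^ 2 / 2)) with hw
  have hwm : ∀ i, Measurable (w i) := fun i => Measurable.indicator (by fun_prop) (hs i)
  have h1 : ∀ x : Fin d → ℝ, (Set.univ.pi s).indicator
      (fun x => ENNReal.ofReal (Real.exp (∑ i, (a i * x i - a i ^ 2 / 2)))) x
        = ∏ i, w i (x i) := by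
    intro x
    by_cases hx : x ∈ Set.univ.pi s
    · rw [Set.indicator_of_mem hx, Real.exp_sum,
        ENNReal.ofReal_prod_of_nonneg fun i _ => (Real.exp_pos _).le]
      refine Finset.prod_congr rfl fun i _ => ?_
      rw [hw]
      simp only
      rw [Set.indicator_of_mem (hx i (Set.mem_univ i))]
    · rw [Set.indicator_of_notMem hx]
      simp only [Set.mem_pi, Set.mem_univ, true_imp_iff, not_forall] at hx
      obtain ⟨i, hi⟩ := hx
      refine (Finset.prod_eq_zero (Finset.mem_univ i) ?_).symm
      rw [hw]
      simp only
      rw [Set.indicator_of_notMem hi]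
  simp_rw [h1]
  have hind : iIndepFun (fun (i : Fin d) (x : Fin d → ℝ) => w i (x i))
      (Measure.pi fun _ : Fin d => gaussianReal 0 1) :=
    iIndepFun_pi fun i => (hwm i).aemeasurable
  rw [lintegral_prod_eq_prod_lintegral_of_indepFun Finset.univ _ hind
    fun i => (hwm i).comp (measurable_pi_apply i)]
  refine Finset.prod_congr rfl fun i _ => ?_
  have h2 : ∫⁻ x : Fin d → ℝ, w i (x i) ∂(Measure.pi fun _ : Fin d => gaussianReal 0 1)
      = ∫⁻ y, w i y ∂(gaussianReal 0 1) :=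
    (measurePreserving_eval (fun _ : Fin d => gaussianReal 0 1) i).lintegral_comp (hwm i)
  rw [h2, hw]
  simp only
  rw [lintegral_indicator (hs i), ← withDensity_apply _ (hs i), gaussianReal_withDensity_exp]

instance : IsProbabilityMeasure (_root_.stdGaussian d) :=
  Measure.isProbabilityMeasure_map (by fun_prop)

lemma lintegral_stdGaussian_add (b : EuclideanSpace ℝ (Fin d))
    {f : EuclideanSpace ℝ (Fin d) → ENNReal} (hf : Measurable f) :
    ∫⁻ z, f (z + b) ∂(_root_.stdGaussian d)
      = ∫⁻ z, ENNReal.ofReal (Real.exp (∑ i, (b i * z i - b i ^ 2 / 2))) * f z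
          ∂(_root_.stdGaussian d) := by
  have he : Measurable (⇑(EuclideanSpace.equiv (Fin d) ℝ).symm) :=
    (EuclideanSpace.equiv (Fin d) ℝ).symm.continuous.measurable
  have hfe : Measurable fun x => f ((EuclideanSpace.equiv (Fin d) ℝ).symm x) := hf.comp he
  have hshift : (Measure.pi fun _ : Fin d => gaussianReal 0 1).map (fun x i => x i + b i)
      = Measure.pi fun i => gaussianReal (b i) 1 := by
    rw [Measure.pi_map_pi (f := fun i y => y + b i) fun i => by fun_prop]
    congr 1
    ext1 i
    rw [gaussianReal_map_add_const, zero_add]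
  unfold _root_.stdGaussian
  rw [lintegral_map (by fun_prop) he, lintegral_map (by fun_prop) he]
  calc ∫⁻ x, f ((EuclideanSpace.equiv (Fin d) ℝ).symm x + b)
        ∂(Measure.pi fun _ : Fin d => gaussianReal 0 1)
      = ∫⁻ x, f ((EuclideanSpace.equiv (Fin d) ℝ).symm x)
        ∂((Measure.pi fun _ : Fin d => gaussianReal 0 1).map (fun x i => x i + b i)) := by
        rw [lintegral_map hfe (by fun_prop)]
        rfl
    _ = _ := by
        rw [hshift, ← pi_gaussianReal_withDensity_exp,
          lintegral_withDensity_eq_lintegral_mul _ (by fun_prop) hfe]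
        rfl

lemma lintegral_stdGaussian_add_le {p q : ℝ} (hpq : p.HolderConjugate q)
    (b : EuclideanSpace ℝ (Fin d)) {f : EuclideanSpace ℝ (Fin d) → ENNReal}
    (hf : Measurable f) :
    ∫⁻ z, f (z + b) ∂(_root_.stdGaussian d)
      ≤ ENNReal.ofReal (Real.exp ((p - 1) * (‖b‖ ^ 2 / 2)))
          * (∫⁻ z, f z ^ q ∂(_root_.stdGaussian d)) ^ (1 / q) := by
  have hp := hpq.pos
  have hnorm : ‖b‖ ^ 2 = ∑ i, b i ^ 2 := by
    simp [EuclideanSpace.norm_sq_eq]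
  have hpow : ∀ z : EuclideanSpace ℝ (Fin d),
      ENNReal.ofReal (Real.exp (∑ i, (b i * z i - b i ^ 2 / 2))) ^ p
        = ENNReal.ofReal (Real.exp (p * ((p - 1) * (‖b‖ ^ 2 / 2))))
          * (ENNReal.ofReal (Real.exp (∑ i, ((p • b) i * z i - (p • b) i ^ 2 / 2)))
            * (fun _ => 1) z) := by
    intro z
    rw [mul_one, ← ENNReal.ofReal_mul (Real.exp_pos _).le, ← Real.exp_add,
      ENNReal.ofReal_rpow_of_pos (Real.exp_pos _), ← Real.exp_mul, hnorm]
    congr 2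
    simp only [PiLp.smul_apply, smul_eq_mul, Finset.sum_sub_distrib, ← Finset.sum_div, mul_pow,
      ← Finset.mul_sum, mul_assoc]
    ring
  rw [lintegral_stdGaussian_add b hf]
  refine (ENNReal.lintegral_mul_le_Lp_mul_Lq _ hpq (by fun_prop) hf.aemeasurable).trans ?_
  gcongr
  simp_rw [hpow]
  rw [lintegral_const_mul _ (by fun_prop), ← lintegral_stdGaussian_add (p • b) measurable_const,
    lintegral_one, measure_univ, mul_one, ENNReal.ofReal_rpow_of_pos (Real.exp_pos _),
    ← Real.exp_mul]
  refine le_of_eq ?_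
  congr 2
  field_simp

/-- Rényi divergence between two noisy iterations with a contractive drift, for an arbitrary
admissible sequence `w` of bounds on the distance between the two coupled iterates. -/
lemma renyiDiv_noisy_iteration_le {α : ℝ} (hα : 1 < α) {τ c s : ℝ} (hτ : 0 < τ)
    {T T' proj : EuclideanSpace ℝ (Fin d) → EuclideanSpace ℝ (Fin d)}
    (hT : Measurable T) (hT' : Measurable T') (hproj : Measurable proj)
    (hproj1 : ∀ x y, ‖proj x - proj y‖ ≤ ‖x - y‖)
    (hc : 0 ≤ c) (hs : 0 ≤ s) (hTT' : ∀ x y, ‖T x - T' y‖ ≤ c * ‖x - y‖ + s)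
    {μ μ' : ℕ → Measure (EuclideanSpace ℝ (Fin d))} [IsProbabilityMeasure (μ 0)]
    (h0 : μ 0 = μ' 0)
    (hμ : ∀ k, μ (k + 1) = ((μ k).prod (_root_.stdGaussian d)).map
      fun q => proj (T q.1 + τ • q.2))
    (hμ' : ∀ k, μ' (k + 1) = ((μ' k).prod (_root_.stdGaussian d)).map
      fun q => proj (T' q.1 + τ • q.2))
    (K : ℕ) {w : ℕ → ℝ} (hw : ∀ k, k ≤ K → 0 ≤ w k) (hwK : w K = 0)
    (hA : ∀ k < K, w (k + 1) ≤ c * w k + s) :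
    renyiDiv α (μ K) (μ' K)
      ≤ α * ∑ k ∈ Finset.range K, (c * w k + s - w (k + 1)) ^ 2 / (2 * τ ^ 2) := by
  have hpq : α.HolderConjugate α.conjExponent := Real.HolderConjugate.conjExponent hα
  set q := α.conjExponent
  have key : ∀ k, k ≤ K → ∃ P Q : Measure (EuclideanSpace ℝ (Fin d) × EuclideanSpace ℝ (Fin d)),
      IsProbabilityMeasure P ∧ IsProbabilityMeasure Q ∧ P.map Prod.fst = μ k ∧
      Q.map Prod.snd = μ' k ∧ (∀ᵐ p ∂P, ‖p.1 - p.2‖ ≤ w k) ∧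
      HolderDominated q (ENNReal.ofReal (Real.exp ((α - 1) *
        ∑ j ∈ Finset.range k, (c * w j + s - w (j + 1)) ^ 2 / (2 * τ ^ 2)))) P Q := by
    intro k
    induction k with
    | zero =>
      intro hk
      have hdiag : Measurable fun x : EuclideanSpace ℝ (Fin d) => (x, x) := by fun_prop
      have hP : IsProbabilityMeasure ((μ 0).map fun x => (x, x)) :=
        Measure.isProbabilityMeasure_map hdiag.aemeasurable
      refine ⟨(μ 0).map fun x => (x, x), (μ 0).map fun x => (x, x), hP, hP, ?_, ?_, ?_, ?_⟩
      · rw [Measure.map_map measurable_fst hdiag]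
        exact Measure.map_id
      · rw [Measure.map_map measurable_snd hdiag, ← h0]
        exact Measure.map_id
      · refine (ae_map_iff hdiag.aemeasurable
          (measurableSet_le (by fun_prop) measurable_const)).2 (Filter.Eventually.of_forall ?_)
        intro x
        simpa using hw 0 hk
      · simpa using HolderDominated.refl hpq ((μ 0).map fun x => (x, x))
    | succ k ih =>
      intro hk
      obtain ⟨P, Q, hP, hQ, hPμ, hQμ, hsupp, hdom⟩ := ih (by omega)
      set m := c * w k + s with hm
      have hm0 : 0 ≤ m := add_nonneg (mul_nonneg hc (hw k (by omega))) hs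
      have hAk : 0 ≤ m - w (k + 1) := sub_nonneg.2 (hA k (by omega))
      set ρ := (m - w (k + 1)) / m with hρ
      have hρm : ρ * m ≤ m - w (k + 1) := by
        rcases hm0.eq_or_lt with h | h
        · rw [← h] at hAk ⊢
          simpa using hAk
        · rw [hρ, div_mul_cancel₀ _ h.ne']
      have hρ0 : 0 ≤ ρ := div_nonneg hAk hm0
      have hρ1 : ρ ≤ 1 := div_le_one_of_le₀ (by linarith [hw (k + 1) hk]) hm0
      have hρm' : (1 - ρ) * m ≤ w (k + 1) := by
        rcases hm0.eq_or_lt with h | h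
        · rw [← h, mul_zero]
          exact hw (k + 1) hk
        · rw [hρ, sub_mul, div_mul_cancel₀ _ h.ne']
          linarith
      let φ : (EuclideanSpace ℝ (Fin d) × EuclideanSpace ℝ (Fin d)) × EuclideanSpace ℝ (Fin d) →
          EuclideanSpace ℝ (Fin d) × EuclideanSpace ℝ (Fin d) := fun r =>
        (proj (T r.1.1 + τ • r.2),
          proj (T' r.1.2 + ρ • (T r.1.1 - T' r.1.2) + τ • r.2))
      let ψ : (EuclideanSpace ℝ (Fin d) × EuclideanSpace ℝ (Fin d)) × EuclideanSpace ℝ (Fin d) →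
          EuclideanSpace ℝ (Fin d) × EuclideanSpace ℝ (Fin d) := fun r =>
        (proj (T r.1.1 - ρ • (T r.1.1 - T' r.1.2) + τ • r.2), proj (T' r.1.2 + τ • r.2))
      have hφ : Measurable φ := by fun_prop
      have hψ : Measurable ψ := by fun_prop
      refine ⟨(P.prod (_root_.stdGaussian d)).map φ, (Q.prod (_root_.stdGaussian d)).map ψ,
        Measure.isProbabilityMeasure_map hφ.aemeasurable,
        Measure.isProbabilityMeasure_map hψ.aemeasurable, ?_, ?_, ?_, ?_⟩
      · rw [Measure.map_map measurable_fst hφ, hμ, ← hPμ]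
        conv_rhs => rw [← Measure.map_id (μ := _root_.stdGaussian d)]
        rw [Measure.map_prod_map _ _ measurable_fst measurable_id,
          Measure.map_map (by fun_prop) (by fun_prop)]
        rfl
      · rw [Measure.map_map measurable_snd hψ, hμ', ← hQμ]
        conv_rhs => rw [← Measure.map_id (μ := _root_.stdGaussian d)]
        rw [Measure.map_prod_map _ _ measurable_snd measurable_id,
          Measure.map_map (by fun_prop) (by fun_prop)]
        rfl
      · refine (ae_map_iff hφ.aemeasurable
          (measurableSet_le (by fun_prop) measurable_const)).2 ?_
        have hsupp' : ∀ᵐ r ∂(P.prod (_root_.stdGaussian d)), ‖r.1.1 - r.1.2‖ ≤ w k :=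
          Measure.quasiMeasurePreserving_fst.ae hsupp
        filter_upwards [hsupp'] with r hr
        refine (hproj1 _ _).trans ?_
        have h1 : T r.1.1 + τ • r.2 - (T' r.1.2 + ρ • (T r.1.1 - T' r.1.2) + τ • r.2)
            = (1 - ρ) • (T r.1.1 - T' r.1.2) := by module
        rw [h1, norm_smul, Real.norm_of_nonneg (by linarith)]
        refine le_trans ?_ hρm'
        refine mul_le_mul_of_nonneg_left ((hTT' _ _).trans ?_) (by linarith)
        rw [hm]
        gcongr
      · rw [Finset.sum_range_succ, mul_add, Real.exp_add, mul_comm,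
          ENNReal.ofReal_mul (Real.exp_pos _).le]
        refine hdom.map_prod hpq.symm.pos hφ hψ ?_
        filter_upwards [hsupp] with p hp f hf
        have hshift : ∀ z, φ (p, z) = ψ (p, z + τ⁻¹ • ρ • (T p.1 - T' p.2)) := by
          intro z
          simp only [φ, ψ, smul_add, smul_inv_smul₀ hτ.ne']
          congr 2 <;> module
        simp_rw [hshift]
        have hf' : Measurable fun z => f (ψ (p, z)) := by fun_prop
        refine (lintegral_stdGaussian_add_le hpq (τ⁻¹ • ρ • (T p.1 - T' p.2)) hf').trans ?_
        gcongr ENNReal.ofReal (Real.exp ?_) * _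
        rw [norm_smul, norm_smul, Real.norm_of_nonneg hρ0,
          Real.norm_of_nonneg (inv_nonneg.2 hτ.le)]
        have h2 : ρ * ‖T p.1 - T' p.2‖ ≤ m - w (k + 1) := by
          refine le_trans ?_ hρm
          refine mul_le_mul_of_nonneg_left ((hTT' _ _).trans ?_) hρ0
          rw [hm]
          gcongr
        calc (α - 1) * ((τ⁻¹ * (ρ * ‖T p.1 - T' p.2‖)) ^ 2 / 2)
            ≤ (α - 1) * ((τ⁻¹ * (m - w (k + 1))) ^ 2 / 2) := by
              have : 0 ≤ α - 1 := by linarith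
              gcongr
          _ = (α - 1) * ((m - w (k + 1)) ^ 2 / (2 * τ ^ 2)) := by
              field_simp
  obtain ⟨P, Q, hP, hQ, hPμ, hQμ, hsupp, hdom⟩ := key K le_rfl
  have hPsnd : P.map Prod.snd = μ K := by
    rw [← hPμ]
    refine Measure.map_congr ?_
    filter_upwards [hsupp] with p hp
    rw [hwK] at hp
    exact (sub_eq_zero.1 (norm_le_zero_iff.1 hp)).symm
  have hfin : IsProbabilityMeasure (μ' K) := by
    rw [← hQμ]
    exact Measure.isProbabilityMeasure_map measurable_snd.aemeasurable
  refine renyiDiv_le_of_holderDominated hpq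
    (Finset.sum_nonneg fun k _ => div_nonneg (sq_nonneg _) (by positivity)) ?_
  rw [← hPsnd, ← hQμ]
  exact hdom.map measurable_snd

section Contraction

variable {E : Type*} [NormedAddCommGroup E] [InnerProductSpace ℝ E]

/-- A gradient step contracts between two points as soon as the points obtained from them by a
suitable further step stay in the domain. -/
lemma norm_sub_smul_sub_le_of_mem {C : Set E} {f : E → ℝ} {G : E → E} {lam η : ℝ} (hη : 0 < η)
    (hηlam : η * lam < 1)
    (hlower : ∀ x ∈ C, ∀ y ∈ C, f x + ⟪G x, y - x⟫ + lam / 2 * ‖y - x‖ ^ 2 ≤ f y)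
    (hupper : ∀ x ∈ C, ∀ y ∈ C, f y ≤ f x + ⟪G x, y - x⟫ + 1 / (2 * η) * ‖y - x‖ ^ 2)
    {x y v : E} (hx : x ∈ C) (hy : y ∈ C)
    (hv : (1 / η - lam) • v = G y - G x - lam • (y - x)) (hyv : y - v ∈ C) (hxv : x + v ∈ C) :
    ‖x - y - η • (G x - G y)‖ ≤ (1 - η * lam) * ‖x - y‖ := by
  obtain ⟨e, rfl⟩ : ∃ e, y = x + e := ⟨y - x, by abel⟩
  set L := 1 / η - lam with hL
  have hηL : η * L = 1 - η * lam := by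
    rw [hL]; field_simp
  have hLpos : 0 < L := by
    by_contra! h
    nlinarith [mul_nonpos_of_nonneg_of_nonpos hη.le h]
  have hGy : G (x + e) = G x + L • v + lam • e := by
    rw [hv]; module
  have h1 := hlower x hx _ hyv
  have h2 := hupper _ hy _ hyv
  have h3 := hlower _ hy _ hxv
  have h4 := hupper x hx _ hxv
  rw [show x + e - v - x = e - v by abel] at h1
  rw [show x + e - v - (x + e) = -v by abel, hGy] at h2
  rw [show x + v - (x + e) = -(e - v) by abel, hGy] at h3
  rw [show x + v - x = v by abel] at h4
  rw [norm_neg] at h2 h3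
  rw [norm_sub_sq_real] at h1 h3
  simp only [inner_add_left, inner_sub_right, inner_neg_right, real_inner_smul_left,
    real_inner_self_eq_norm_sq] at h1 h2 h3 h4
  have hcoc : L * ‖v‖ ^ 2 ≤ L * ⟪v, e⟫ := by
    have hL' : 1 / (2 * η) = (L + lam) / 2 := by
      rw [hL]; field_simp; ring
    rw [hL'] at h2 h4
    have := real_inner_comm v e
    nlinarith
  have hstep : x - (x + e) - η • (G x - G (x + e)) = -((η * L) • (e - v)) := by
    rw [hGy]
    have : e = (η * L + η * lam) • e := by
      rw [hηL]; module
    have h5 : x - (x + e) - η • (G x - (G x + L • v + lam • e))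
        = -e + η • (L • v + lam • e) := by module
    rw [h5]
    nth_rewrite 1 [this]
    module
  rw [hstep, norm_neg, norm_smul, Real.norm_of_nonneg (by positivity), ← hηL]
  refine mul_le_mul_of_nonneg_left ?_ (by positivity)
  rw [show x - (x + e) = -e by abel, norm_neg]
  refine le_of_sq_le_sq ?_ (norm_nonneg _)
  rw [norm_sub_sq_real]
  have := real_inner_comm v e
  have := le_of_mul_le_mul_left hcoc hLpos
  nlinarith [sq_nonneg ‖v‖]

lemma le_add_inner_add_of_lipschitz_gradient {C : Set E} (hC : Convex ℝ C) {f : E → ℝ} {G : E → E}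
    {β : ℝ} (hlower : ∀ x ∈ C, ∀ y ∈ C, f x + ⟪G x, y - x⟫ ≤ f y)
    (hG : ∀ x ∈ C, ∀ y ∈ C, ‖G x - G y‖ ≤ β * ‖x - y‖) {η : ℝ} (hη : 0 < η) (hηβ : η * β < 1)
    (x : E) (hx : x ∈ C) (y : E) (hy : y ∈ C) :
    f y ≤ f x + ⟪G x, y - x⟫ + 1 / (2 * η) * ‖y - x‖ ^ 2 := by
  have key : ∀ n : ℕ, ∀ x ∈ C, ∀ y ∈ C,
      f y ≤ f x + ⟪G x, y - x⟫ + (β / 2 + β / 2 * (1 / 2) ^ n) * ‖y - x‖ ^ 2 := by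
    intro n
    induction n with
    | zero =>
      intro x hx y hy
      have h1 := hlower y hy x hx
      have h2 := (real_inner_le_norm (G y - G x) (y - x)).trans
        (mul_le_mul_of_nonneg_right (hG y hy x hx) (norm_nonneg _))
      rw [inner_sub_left] at h2
      rw [← neg_sub y x, inner_neg_right] at h1
      nlinarith
    | succ n ih =>
      intro x hx y hy
      obtain ⟨e, rfl⟩ : ∃ e, y = x + (2 : ℝ) • e :=
        ⟨(1 / 2 : ℝ) • (y - x), by rw [smul_smul]; norm_num⟩
      have hm : x + e ∈ C := by
        have := hC.add_smul_sub_mem hx hy (t := 1 / 2) ⟨by norm_num, by norm_num⟩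
        rwa [add_sub_cancel_left, smul_smul, show (1 / 2 : ℝ) * 2 = 1 by norm_num, one_smul] at this
      have h1 := ih x hx _ hm
      have h2 := ih _ hm _ hy
      have h3 := (real_inner_le_norm (G (x + e) - G x) e).trans
        (mul_le_mul_of_nonneg_right (hG _ hm x hx) (norm_nonneg _))
      rw [show x + (2 : ℝ) • e - (x + e) = e by module] at h2
      rw [add_sub_cancel_left] at h1 h3 ⊢
      rw [inner_smul_right, norm_smul, mul_pow, pow_succ]
      rw [inner_sub_left] at h3
      norm_num
      nlinarith
  rcases le_or_gt β 0 with hβ | hβ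
  · refine (key 0 x hx y hy).trans ?_
    have : (0 : ℝ) ≤ 1 / (2 * η) := by positivity
    gcongr
    rw [pow_zero]
    linarith
  · have hgap : 0 < 1 / (2 * η) - β / 2 := by
      rw [sub_pos, div_lt_div_iff₀ two_pos (by positivity)]
      linarith
    obtain ⟨n, hn⟩ := exists_pow_lt_of_lt_one (div_pos hgap (half_pos hβ))
      (show (1 / 2 : ℝ) < 1 by norm_num)
    rw [lt_div_iff₀ (half_pos hβ)] at hn
    refine (key n x hx y hy).trans ?_
    gcongr
    linarith

lemma norm_sub_smul_sub_le_of_ball {C : Set E} (hC : Convex ℝ C) {V : Submodule ℝ E} {f : E → ℝ}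
    {G : E → E} {lam β η r : ℝ} (hlam : 0 ≤ lam) (hη : 0 < η) (hηlam : η * lam < 1)
    (hηβ : η * β < 1)
    (hlower : ∀ x ∈ C, ∀ y ∈ C, f x + ⟪G x, y - x⟫ + lam / 2 * ‖y - x‖ ^ 2 ≤ f y)
    (hG : ∀ x ∈ C, ∀ y ∈ C, ‖G x - G y‖ ≤ β * ‖x - y‖) (hGV : ∀ x, G x ∈ V)
    (hr : 0 < r) {x y : E} (hxy : y - x ∈ V) (hx : ∀ v ∈ V, ‖v‖ ≤ r → x + v ∈ C)
    (hy : ∀ v ∈ V, ‖v‖ ≤ r → y + v ∈ C) :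
    ‖x - y - η • (G x - G y)‖ ≤ (1 - η * lam) * ‖x - y‖ := by
  set L := 1 / η - lam with hL
  have hLpos : 0 < L := by
    rw [hL, sub_pos, lt_div_iff₀ hη]
    linarith
  have hupper := le_add_inner_add_of_lipschitz_gradient hC (f := f)
    (fun x hx y hy => le_trans (by nlinarith [sq_nonneg ‖y - x‖]) (hlower x hx y hy)) hG hη hηβ
  obtain ⟨N, hN⟩ := exists_nat_gt ((β + lam) * ‖y - x‖ / (L * r))
  have hN' : (β + lam) * ‖y - x‖ ≤ (N + 1) * (L * r) := by
    rw [div_lt_iff₀ (by positivity)] at hN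
    nlinarith [mul_pos hLpos hr]
  have hN0 : (0 : ℝ) < N + 1 := by positivity
  set p : ℕ → E := fun i => x + ((i : ℝ) / (N + 1)) • (y - x) with hp
  have hpC : ∀ i ≤ N + 1, ∀ v ∈ V, ‖v‖ ≤ r → p i + v ∈ C := by
    intro i hi v hv hvr
    have ht : (i : ℝ) / (N + 1) ∈ Set.Icc (0 : ℝ) 1 :=
      ⟨by positivity, div_le_one_of_le₀ (by exact_mod_cast hi) hN0.le⟩
    have := hC.add_smul_sub_mem (hx v hv hvr) (hy v hv hvr) ht
    rwa [show x + v + ((i : ℝ) / (N + 1)) • (y + v - (x + v)) = p i + v by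
      simp only [hp]; module] at this
  have hpC0 : ∀ i ≤ N + 1, p i ∈ C := fun i hi => by
    simpa using hpC i hi 0 V.zero_mem (by simpa using hr.le)
  have hdiff : ∀ i, p (i + 1) - p i = (1 / ((N : ℝ) + 1)) • (y - x) := by
    intro i
    simp only [hp]
    push_cast
    rw [add_div]
    module
  have hstep : ∀ i < N + 1, dist (p i - η • G (p i)) (p (i + 1) - η • G (p (i + 1)))
      ≤ (1 - η * lam) * (1 / ((N : ℝ) + 1) * ‖x - y‖) := by
    intro i hi
    have h0 := hpC0 i (by omega)
    have h1 := hpC0 (i + 1) (by omega)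
    have hn : ‖p (i + 1) - p i‖ = 1 / ((N : ℝ) + 1) * ‖y - x‖ := by
      rw [hdiff, norm_smul, Real.norm_of_nonneg (by positivity)]
    set v := L⁻¹ • (G (p (i + 1)) - G (p i) - lam • (p (i + 1) - p i)) with hv
    have hvV : v ∈ V := by
      refine V.smul_mem _ (V.sub_mem (V.sub_mem (hGV _) (hGV _)) (V.smul_mem _ ?_))
      rw [hdiff]
      exact V.smul_mem _ hxy
    have hvr : ‖v‖ ≤ r := by
      rw [hv, norm_smul, Real.norm_of_nonneg (by positivity), inv_mul_le_iff₀ hLpos]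
      calc ‖G (p (i + 1)) - G (p i) - lam • (p (i + 1) - p i)‖
          ≤ ‖G (p (i + 1)) - G (p i)‖ + ‖lam • (p (i + 1) - p i)‖ := norm_sub_le _ _
        _ ≤ β * ‖p (i + 1) - p i‖ + lam * ‖p (i + 1) - p i‖ := by
            rw [norm_smul, Real.norm_of_nonneg hlam]
            gcongr
            exact hG _ h1 _ h0
        _ = ((β + lam) * ‖y - x‖) / (N + 1) := by
            rw [hn]; field_simp
        _ ≤ L * r := by
            rw [div_le_iff₀ hN0]
            linarith
    have := norm_sub_smul_sub_le_of_mem hη hηlam hlower hupper h0 h1 (v := v)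
      (by rw [hv, ← hL, smul_inv_smul₀ hLpos.ne'])
      (by
        rw [sub_eq_add_neg]
        exact hpC (i + 1) (by omega) _ (V.neg_mem hvV) (by rwa [norm_neg]))
      (hpC i (by omega) _ hvV hvr)
    rw [norm_sub_rev (p i), hn, norm_sub_rev y x] at this
    rw [dist_eq_norm]
    refine le_trans (le_of_eq ?_) this
    congr 1
    module
  have hsum := (dist_le_range_sum_dist (fun i => p i - η • G (p i)) (N + 1)).trans
    (Finset.sum_le_sum fun i hi => hstep i (Finset.mem_range.1 hi))
  have hp0 : p 0 = x := by simp [hp]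
  have hpN : p (N + 1) = y := by
    simp only [hp]
    push_cast
    rw [div_self hN0.ne']
    module
  simp only [hp0, hpN, Finset.sum_const, Finset.card_range, nsmul_eq_mul] at hsum
  rw [dist_eq_norm] at hsum
  calc ‖x - y - η • (G x - G y)‖ = ‖x - η • G x - (y - η • G y)‖ := by congr 1; module
    _ ≤ _ := hsum
    _ = (1 - η * lam) * ‖x - y‖ := by
        push_cast
        field_simp

/-- The gradient step of a strongly convex smooth function contracts on a convex set, provided
the gradient is tangent to the affine hull of that set. -/
lemma norm_sub_smul_sub_le_of_convex [FiniteDimensional ℝ E] {C : Set E} (hC : Convex ℝ C)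
    {f : E → ℝ}
    {G : E → E} {lam β η : ℝ} (hlam : 0 ≤ lam) (hη : 0 < η) (hηlam : η * lam < 1)
    (hηβ : η * β < 1)
    (hlower : ∀ x ∈ C, ∀ y ∈ C, f x + ⟪G x, y - x⟫ + lam / 2 * ‖y - x‖ ^ 2 ≤ f y)
    (hG : ∀ x ∈ C, ∀ y ∈ C, ‖G x - G y‖ ≤ β * ‖x - y‖)
    (hGV : ∀ x, G x ∈ (affineSpan ℝ C).direction) {x y : E} (hx : x ∈ C) (hy : y ∈ C) :
    ‖x - y - η • (G x - G y)‖ ≤ (1 - η * lam) * ‖x - y‖ := by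
  obtain ⟨p, hp⟩ := Set.Nonempty.intrinsicInterior hC ⟨x, hx⟩
  obtain ⟨p, hp, rfl⟩ := hp
  rw [mem_interior_iff_mem_nhds, Metric.mem_nhds_iff] at hp
  obtain ⟨r, hr, hball⟩ := hp
  have hpC : ∀ v ∈ (affineSpan ℝ C).direction, ‖v‖ ≤ r / 2 → (p : E) + v ∈ C := by
    intro v hv hvr
    have hmem : v +ᵥ (p : E) ∈ affineSpan ℝ C :=
      AffineSubspace.vadd_mem_of_mem_direction hv p.2
    have : (⟨v +ᵥ (p : E), hmem⟩ : affineSpan ℝ C) ∈ Metric.ball p r := by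
      rw [Metric.mem_ball, Subtype.dist_eq]
      simp only [vadd_eq_add, dist_eq_norm, add_sub_cancel_right]
      linarith
    have hmemC : v +ᵥ (p : E) ∈ C := hball this
    rwa [vadd_eq_add, add_comm] at hmemC
  have hdir : ∀ a ∈ C, ∀ b ∈ C, b - a ∈ (affineSpan ℝ C).direction := fun a ha b hb =>
    AffineSubspace.vsub_mem_direction (subset_affineSpan ℝ C hb) (subset_affineSpan ℝ C ha)
  have hp0 : (p : E) ∈ C := by
    simpa using hpC 0 (Submodule.zero_mem _) (by rw [norm_zero]; positivity)
  have hmove : ∀ a ∈ C, ∀ t ∈ Set.Ioc (0 : ℝ) 1, ∀ v ∈ (affineSpan ℝ C).direction,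
      ‖v‖ ≤ t * (r / 2) → a + t • ((p : E) - a) + v ∈ C := by
    intro a ha t ht v hv hvr
    have h1 : ‖t⁻¹ • v‖ ≤ r / 2 := by
      rw [norm_smul, Real.norm_of_nonneg (inv_nonneg.2 ht.1.le), inv_mul_le_iff₀ ht.1]
      exact hvr
    have := hC.add_smul_sub_mem ha (hpC _ (Submodule.smul_mem _ t⁻¹ hv) h1) ⟨ht.1.le, ht.2⟩
    convert this using 1
    rw [show (p : E) + t⁻¹ • v - a = (p - a) + t⁻¹ • v by abel, smul_add,
      smul_inv_smul₀ ht.1.ne', add_assoc]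
  have hmove0 : ∀ a ∈ C, ∀ t ∈ Set.Ioc (0 : ℝ) 1, a + t • ((p : E) - a) ∈ C := by
    intro a ha t ht
    simpa using hmove a ha t ht 0 (Submodule.zero_mem _)
      (by rw [norm_zero]; have := ht.1; positivity)
  have hshift : ∀ a ∈ C, ∀ t ∈ Set.Ioc (0 : ℝ) 1,
      ‖(a - η • G a) - (a + t • ((p : E) - a) - η • G (a + t • ((p : E) - a)))‖
        ≤ t * ((1 + η * β) * ‖(p : E) - a‖) := by
    intro a ha t ht
    have h1 := hG _ (hmove0 a ha t ht) _ ha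
    rw [add_sub_cancel_left, norm_smul, Real.norm_of_nonneg ht.1.le] at h1
    calc _ = ‖η • (G (a + t • ((p : E) - a)) - G a) - t • ((p : E) - a)‖ := by
          congr 1; module
      _ ≤ ‖η • (G (a + t • ((p : E) - a)) - G a)‖ + ‖t • ((p : E) - a)‖ := norm_sub_le _ _
      _ ≤ η * (β * (t * ‖(p : E) - a‖)) + t * ‖(p : E) - a‖ := by
          rw [norm_smul, norm_smul, Real.norm_of_nonneg ht.1.le, Real.norm_of_nonneg hη.le]
          gcongr
      _ = _ := by ring
  set M := (1 + η * β) * ‖(p : E) - x‖ + (1 + η * β) * ‖(p : E) - y‖ with hM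
  have key : ∀ t ∈ Set.Ioc (0 : ℝ) 1,
      ‖x - y - η • (G x - G y)‖ ≤ (1 - η * lam) * ‖x - y‖ + t * M := by
    intro t ht
    have hr2 : 0 < t * (r / 2) := mul_pos ht.1 (half_pos hr)
    have h1 := norm_sub_smul_sub_le_of_ball hC hlam hη hηlam hηβ hlower hG hGV hr2
      (hdir _ (hmove0 x hx t ht) _ (hmove0 y hy t ht)) (hmove x hx t ht) (hmove y hy t ht)
    have h2 : ‖x + t • ((p : E) - x) - (y + t • ((p : E) - y))‖ ≤ ‖x - y‖ := by
      rw [show x + t • ((p : E) - x) - (y + t • ((p : E) - y)) = (1 - t) • (x - y) by module,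
        norm_smul, Real.norm_of_nonneg (by linarith [ht.2])]
      nlinarith [norm_nonneg (x - y), ht.1]
    have h3 := hshift x hx t ht
    have h4 := hshift y hy t ht
    have h5 : (1 - η * lam) * ‖x + t • ((p : E) - x) - (y + t • ((p : E) - y))‖
        ≤ (1 - η * lam) * ‖x - y‖ := mul_le_mul_of_nonneg_left h2 (by linarith)
    set x' := x + t • ((p : E) - x)
    set y' := y + t • ((p : E) - y)
    calc ‖x - y - η • (G x - G y)‖
        = ‖((x - η • G x) - (x' - η • G x')) + (x' - y' - η • (G x' - G y'))
            - ((y - η • G y) - (y' - η • G y'))‖ := by congr 1; module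
      _ ≤ _ := norm_sub_le_of_le (norm_add_le_of_le h3 (h1.trans h5)) h4
      _ = _ := by rw [hM]; ring
  have hlim : Filter.Tendsto (fun t : ℝ => (1 - η * lam) * ‖x - y‖ + t * M)
      (nhdsWithin 0 (Set.Ioi 0)) (nhds ((1 - η * lam) * ‖x - y‖ + 0 * M)) :=
    ((by fun_prop : Continuous fun t : ℝ => (1 - η * lam) * ‖x - y‖ + t * M).tendsto 0).mono_left
      nhdsWithin_le_nhds
  rw [zero_mul, add_zero] at hlim
  refine ge_of_tendsto hlim ?_
  filter_upwards [Ioc_mem_nhdsGT (zero_lt_one' ℝ)] with t ht using key t ht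

end Contraction

section Projection

variable {E : Type*} [NormedAddCommGroup E] [InnerProductSpace ℝ E] {C : Set E} {projC : E → E}

lemma inner_sub_nearest_le_zero (hC : Convex ℝ C) {θ p : E} (hp : p ∈ C)
    (hmin : ∀ y ∈ C, ‖θ - p‖ ≤ ‖θ - y‖) {y : E} (hy : y ∈ C) : ⟪θ - p, y - p⟫ ≤ 0 := by
  have key : ∀ t ∈ Set.Ioc (0 : ℝ) 1, 2 * ⟪θ - p, y - p⟫ ≤ t * ‖y - p‖ ^ 2 := by
    intro t ht
    have h1 := hmin _ (hC.add_smul_sub_mem hp hy ⟨ht.1.le, ht.2⟩)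
    have h2 := pow_le_pow_left₀ (norm_nonneg _) h1 2
    rw [show θ - (p + t • (y - p)) = (θ - p) - t • (y - p) by module, norm_sub_sq_real (θ - p),
      inner_smul_right, norm_smul, Real.norm_of_nonneg ht.1.le] at h2
    refine le_of_mul_le_mul_left ?_ ht.1
    nlinarith
  by_contra! h
  by_cases h0 : ‖y - p‖ ^ 2 ≤ ⟪θ - p, y - p⟫
  · have := key 1 ⟨one_pos, le_rfl⟩
    linarith
  · push Not at h0
    have hpos : 0 < ‖y - p‖ ^ 2 := h.trans h0
    have := key (⟪θ - p, y - p⟫ / ‖y - p‖ ^ 2) ⟨by positivity, (div_le_one hpos).2 h0.le⟩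
    rw [div_mul_cancel₀ _ hpos.ne'] at this
    linarith

lemma norm_sq_nearest_sub_le_inner (hC : Convex ℝ C)
    (hproj : ∀ θ : E, projC θ ∈ C ∧ ∀ y ∈ C, ‖θ - projC θ‖ ≤ ‖θ - y‖) (x y : E) :
    ‖projC x - projC y‖ ^ 2 ≤ ⟪x - y, projC x - projC y⟫ := by
  have h1 := inner_sub_nearest_le_zero hC (hproj x).1 (hproj x).2 (hproj y).1
  have h2 := inner_sub_nearest_le_zero hC (hproj y).1 (hproj y).2 (hproj x).1
  rw [← neg_sub (projC x) (projC y), inner_neg_right] at h1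
  have h3 : x - y = (x - projC x) - (y - projC y) + (projC x - projC y) := by abel
  rw [h3, inner_add_left, inner_sub_left, real_inner_self_eq_norm_sq]
  linarith

lemma norm_nearest_sub_le (hC : Convex ℝ C)
    (hproj : ∀ θ : E, projC θ ∈ C ∧ ∀ y ∈ C, ‖θ - projC θ‖ ≤ ‖θ - y‖) (x y : E) :
    ‖projC x - projC y‖ ≤ ‖x - y‖ := by
  have h := (norm_sq_nearest_sub_le_inner hC hproj x y).trans (real_inner_le_norm _ _)
  by_contra! hlt
  nlinarith [norm_nonneg (x - y)]

lemma nearest_eq_self {E : Type*} [NormedAddCommGroup E] {C : Set E} {projC : E → E}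
    (hproj : ∀ θ : E, projC θ ∈ C ∧ ∀ y ∈ C, ‖θ - projC θ‖ ≤ ‖θ - y‖) {x : E} (hx : x ∈ C) :
    projC x = x := by
  have h := (hproj x).2 x hx
  rw [sub_self, norm_zero] at h
  exact (sub_eq_zero.1 (norm_le_zero_iff.1 h)).symm

lemma nearest_eq_of_sub_mem_orthogonal (hC : Convex ℝ C)
    (hproj : ∀ θ : E, projC θ ∈ C ∧ ∀ y ∈ C, ‖θ - projC θ‖ ≤ ‖θ - y‖) {x y : E}
    (hxy : x - y ∈ (affineSpan ℝ C).directionᗮ) : projC x = projC y := by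
  have h := norm_sq_nearest_sub_le_inner hC hproj x y
  have hmem : projC x - projC y ∈ (affineSpan ℝ C).direction :=
    AffineSubspace.vsub_mem_direction (subset_affineSpan ℝ C (hproj x).1)
      (subset_affineSpan ℝ C (hproj y).1)
  rw [Submodule.inner_left_of_mem_orthogonal hmem hxy] at h
  have h0 : ‖projC x - projC y‖ ^ 2 = 0 := le_antisymm h (sq_nonneg _)
  exact sub_eq_zero.1 (norm_eq_zero.1 (pow_eq_zero_iff two_ne_zero |>.1 h0))

variable [FiniteDimensional ℝ E]

/-- A projected gradient step keeping only the component of `g` tangent to the affine hull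
of `C`. -/
def tangentStep (C : Set E) (projC : E → E) (η : ℝ) (g : E → E) (x : E) : E :=
  projC x - η • (affineSpan ℝ C).direction.starProjection (g (projC x))

lemma nearest_sub_smul_add_eq (hC : Convex ℝ C)
    (hproj : ∀ θ : E, projC θ ∈ C ∧ ∀ y ∈ C, ‖θ - projC θ‖ ≤ ‖θ - y‖) (η : ℝ) (g : E → E)
    {x : E} (hx : x ∈ C) (z : E) :
    projC (x - η • g x + z) = projC (tangentStep C projC η g x + z) := by
  refine nearest_eq_of_sub_mem_orthogonal hC hproj ?_
  rw [tangentStep, nearest_eq_self hproj hx]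
  have h : x - η • g x + z - (x - η • (affineSpan ℝ C).direction.starProjection (g x) + z)
      = (-η) • (g x - (affineSpan ℝ C).direction.starProjection (g x)) := by module
  rw [h]
  exact Submodule.smul_mem _ _ (Submodule.sub_starProjection_mem_orthogonal _)

lemma norm_tangentStep_sub_le (hC : Convex ℝ C)
    (hproj : ∀ θ : E, projC θ ∈ C ∧ ∀ y ∈ C, ‖θ - projC θ‖ ≤ ‖θ - y‖) {f : E → ℝ} {g : E → E}
    {lam β η : ℝ} (hlam : 0 ≤ lam) (hη : 0 < η) (hηlam : η * lam < 1) (hηβ : η * β < 1)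
    (hlower : ∀ x ∈ C, ∀ y ∈ C, f x + ⟪g x, y - x⟫ + lam / 2 * ‖y - x‖ ^ 2 ≤ f y)
    (hg : ∀ x ∈ C, ∀ y ∈ C, ‖g x - g y‖ ≤ β * ‖x - y‖) (x y : E) :
    ‖tangentStep C projC η g x - tangentStep C projC η g y‖ ≤ (1 - η * lam) * ‖x - y‖ := by
  set V := (affineSpan ℝ C).direction
  have h := norm_sub_smul_sub_le_of_convex hC (f := f) (G := fun x => V.starProjection (g x))
    hlam hη hηlam hηβ (fun a ha b hb => by
      have hmem : b - a ∈ V := AffineSubspace.vsub_mem_direction (subset_affineSpan ℝ C hb)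
        (subset_affineSpan ℝ C ha)
      rw [Submodule.inner_starProjection_left_eq_right,
        Submodule.starProjection_eq_self_iff.2 hmem]
      exact hlower a ha b hb)
    (fun a ha b hb => by
      rw [← map_sub]
      exact (Submodule.norm_starProjection_apply_le _ _).trans (hg a ha b hb))
    (fun a => Submodule.starProjection_apply_mem _ _) (hproj x).1 (hproj y).1
  calc ‖tangentStep C projC η g x - tangentStep C projC η g y‖
      = ‖projC x - projC y - η • (V.starProjection (g (projC x))
          - V.starProjection (g (projC y)))‖ := by
        congr 1
        simp only [tangentStep, V]
        module
    _ ≤ (1 - η * lam) * ‖projC x - projC y‖ := h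
    _ ≤ (1 - η * lam) * ‖x - y‖ :=
        mul_le_mul_of_nonneg_left (norm_nearest_sub_le hC hproj x y) (by linarith)

lemma norm_tangentStep_sub_tangentStep_le {η s : ℝ} (hη : 0 ≤ η) {g g' : E → E} (x : E)
    (h : ‖g (projC x) - g' (projC x)‖ ≤ s) :
    ‖tangentStep C projC η g x - tangentStep C projC η g' x‖ ≤ η * s := by
  have h1 : tangentStep C projC η g x - tangentStep C projC η g' x
      = (-η) • (affineSpan ℝ C).direction.starProjection (g (projC x) - g' (projC x)) := by
    rw [map_sub]
    simp only [tangentStep]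
    module
  rw [h1, norm_smul, norm_neg, Real.norm_of_nonneg hη]
  gcongr
  exact (Submodule.norm_starProjection_apply_le _ _).trans h

end Projection

lemma one_sub_exp_neg_bound {x : ℝ} (hx : 0 ≤ x) : x / (1 + x) ≤ 1 - Real.exp (-x) := by
  have h1 : Real.exp (-x) ≤ (1 + x)⁻¹ := by
    rw [Real.exp_neg]
    exact inv_anti₀ (by linarith) (by linarith [Real.add_one_le_exp x])
  have h2 : x / (1 + x) = 1 - (1 + x)⁻¹ := by
    field_simp
    ring
  linarith

/-- A schedule of distances between coupled iterates, starting and ending at zero, for which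
the total squared shift stays bounded uniformly in the number of iterations. -/
lemma exists_shift_schedule {c : ℝ} (hc0 : 0 ≤ c) (hc1 : c < 1) (K : ℕ) :
    ∃ w : ℕ → ℝ, (∀ k, k ≤ K → 0 ≤ w k) ∧ w K = 0 ∧ (∀ k < K, w (k + 1) ≤ c * w k + 1) ∧
      ∑ k ∈ Finset.range K, (c * w k + 1 - w (k + 1)) ^ 2
        ≤ 4 / (1 - c) * (1 - Real.exp (-((1 - c) * K / 2))) := by
  have hu : 0 < 1 - c := by linarith
  have hx : 0 ≤ (1 - c) * K / 2 := by positivity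
  have hexp := one_sub_exp_neg_bound hx
  set x := (1 - c) * K / 2 with hxdef
  rcases le_total x 1 with hx1 | hx1
  · refine ⟨fun _ => 0, fun _ _ => le_rfl, rfl, fun _ _ => by simp, ?_⟩
    have h1 : x / 2 ≤ x / (1 + x) := by
      rw [div_le_div_iff₀ two_pos (by linarith)]
      nlinarith
    have h2 : (K : ℝ) = 4 / (1 - c) * (x / 2) := by
      rw [hxdef]
      field_simp
      norm_num
    calc ∑ k ∈ Finset.range K, (c * 0 + 1 - 0) ^ 2 = (K : ℝ) := by simp
      _ = 4 / (1 - c) * (x / 2) := h2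
      _ ≤ _ := by gcongr; exact h1.trans hexp
  · have hcpow : ∀ m : ℕ, c ^ m ≤ 1 := fun m => pow_le_one₀ hc0 hc1.le
    have hK : 0 < 1 + c ^ K := by positivity
    have hident : ∀ k < K, c * ((1 - c ^ k) * (1 - c ^ (K - k)) / ((1 - c) * (1 + c ^ K))) + 1
        - (1 - c ^ (k + 1)) * (1 - c ^ (K - (k + 1))) / ((1 - c) * (1 + c ^ K))
        = (1 + c) * c ^ (K - 1 - k) / (1 + c ^ K) := by
      intro k hk
      obtain ⟨m, rfl⟩ : ∃ m, K = k + 1 + m := ⟨K - (k + 1), by omega⟩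
      rw [show k + 1 + m - k = m + 1 by omega, show k + 1 + m - (k + 1) = m by omega,
        show k + 1 + m - 1 - k = m by omega]
      field_simp
      ring
    refine ⟨fun k => (1 - c ^ k) * (1 - c ^ (K - k)) / ((1 - c) * (1 + c ^ K)), ?_, ?_, ?_, ?_⟩
    · intro k _
      have h1 := hcpow k
      have h2 := hcpow (K - k)
      exact div_nonneg (mul_nonneg (by linarith) (by linarith)) (by positivity)
    · simp
    · intro k hk
      have h1 := hident k hk
      have h2 : 0 ≤ (1 + c) * c ^ (K - 1 - k) / (1 + c ^ K) := by positivity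
      simp only
      linarith
    · have h1 : (1 / 2 : ℝ) ≤ x / (1 + x) := by
        rw [div_le_div_iff₀ two_pos (by linarith)]
        linarith
      have hgeom : (1 - c ^ 2) * ∑ m ∈ Finset.range K, (c ^ 2) ^ m ≤ 1 := by
        rw [mul_neg_geom_sum]
        have : 0 ≤ (c ^ 2) ^ K := by positivity
        linarith
      calc ∑ k ∈ Finset.range K, (c * ((1 - c ^ k) * (1 - c ^ (K - k))
              / ((1 - c) * (1 + c ^ K))) + 1
            - (1 - c ^ (k + 1)) * (1 - c ^ (K - (k + 1))) / ((1 - c) * (1 + c ^ K))) ^ 2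
          ≤ ∑ k ∈ Finset.range K, (1 + c) ^ 2 * (c ^ 2) ^ (K - 1 - k) := by
            refine Finset.sum_le_sum fun k hk => ?_
            rw [hident k (Finset.mem_range.1 hk)]
            have h3 : (1 + c) * c ^ (K - 1 - k) / (1 + c ^ K) ≤ (1 + c) * c ^ (K - 1 - k) :=
              div_le_self (by positivity) (by linarith [pow_nonneg hc0 K])
            calc _ ≤ ((1 + c) * c ^ (K - 1 - k)) ^ 2 := pow_le_pow_left₀ (by positivity) h3 2
              _ = _ := by ring
        _ = (1 + c) ^ 2 * ∑ m ∈ Finset.range K, (c ^ 2) ^ m := by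
            rw [← Finset.mul_sum, Finset.sum_range_reflect (fun m => (c ^ 2) ^ m)]
        _ ≤ 2 / (1 - c) := by
            rw [le_div_iff₀ hu]
            calc (1 + c) ^ 2 * (∑ m ∈ Finset.range K, (c ^ 2) ^ m) * (1 - c)
                = (1 + c) * ((1 - c ^ 2) * ∑ m ∈ Finset.range K, (c ^ 2) ^ m) := by ring
              _ ≤ (1 + c) * 1 := by gcongr
              _ ≤ 2 := by linarith
        _ = 4 / (1 - c) * (1 / 2) := by ring
        _ ≤ _ := by gcongr; exact h1.trans hexp

lemma coupled_chain_marginals {τ : ℝ} {C : Set (EuclideanSpace ℝ (Fin d))} (hC : MeasurableSet C)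
    {projC F F' T T' : EuclideanSpace ℝ (Fin d) → EuclideanSpace ℝ (Fin d)}
    (hprojm : Measurable projC) (hmem : ∀ θ, projC θ ∈ C) (hT : Measurable T)
    (hT' : Measurable T') (hF : ∀ x ∈ C, ∀ z, projC (F x + z) = projC (T x + z))
    (hF' : ∀ x ∈ C, ∀ z, projC (F' x + z) = projC (T' x + z))
    {ν : ℕ → Measure (EuclideanSpace ℝ (Fin d) × EuclideanSpace ℝ (Fin d))}
    {μ₀ : Measure (EuclideanSpace ℝ (Fin d))} [IsProbabilityMeasure μ₀]
    (hν0 : ν 0 = μ₀.map fun w => (projC w, projC w))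
    (hrec : ∀ k, ν (k + 1) = ((ν k).prod (_root_.stdGaussian d)).map
      fun q => (projC (F q.1.1 + τ • q.2), projC (F' q.1.2 + τ • q.2))) :
    (∀ k, IsProbabilityMeasure (ν k)) ∧ (ν 0).map Prod.fst = (ν 0).map Prod.snd ∧
    (∀ k, (ν (k + 1)).map Prod.fst = (((ν k).map Prod.fst).prod (_root_.stdGaussian d)).map
      fun q => projC (T q.1 + τ • q.2)) ∧
    (∀ k, (ν (k + 1)).map Prod.snd = (((ν k).map Prod.snd).prod (_root_.stdGaussian d)).map
      fun q => projC (T' q.1 + τ • q.2)) := by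
  have hCC : MeasurableSet {p : EuclideanSpace ℝ (Fin d) × EuclideanSpace ℝ (Fin d) |
      p.1 ∈ C ∧ p.2 ∈ C} := hC.prod hC
  have hdiag : Measurable fun w => (projC w, projC w) := by fun_prop
  let Φ : (EuclideanSpace ℝ (Fin d) × EuclideanSpace ℝ (Fin d)) × EuclideanSpace ℝ (Fin d) →
      EuclideanSpace ℝ (Fin d) × EuclideanSpace ℝ (Fin d) := fun q =>
    (projC (T q.1.1 + τ • q.2), projC (T' q.1.2 + τ • q.2))
  have hΦ : Measurable Φ := by fun_prop
  have hstep : ∀ k, (∀ᵐ p ∂(ν k), p.1 ∈ C ∧ p.2 ∈ C) →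
      ν (k + 1) = ((ν k).prod (_root_.stdGaussian d)).map Φ := by
    intro k hk
    rw [hrec]
    refine Measure.map_congr ?_
    have hk' : ∀ᵐ q ∂((ν k).prod (_root_.stdGaussian d)), q.1.1 ∈ C ∧ q.1.2 ∈ C :=
      Measure.quasiMeasurePreserving_fst.ae hk
    filter_upwards [hk'] with q hq
    simp only [Φ, hF _ hq.1, hF' _ hq.2]
  have hsupp : ∀ k, IsProbabilityMeasure (ν k) ∧ ∀ᵐ p ∂(ν k), p.1 ∈ C ∧ p.2 ∈ C := by
    intro k
    induction k with
    | zero =>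
      rw [hν0]
      exact ⟨Measure.isProbabilityMeasure_map hdiag.aemeasurable,
        (ae_map_iff hdiag.aemeasurable hCC).2
          (Filter.Eventually.of_forall fun w => ⟨hmem w, hmem w⟩)⟩
    | succ k ih =>
      have := ih.1
      rw [hstep k ih.2]
      exact ⟨Measure.isProbabilityMeasure_map hΦ.aemeasurable,
        (ae_map_iff hΦ.aemeasurable hCC).2
          (Filter.Eventually.of_forall fun w => ⟨hmem _, hmem _⟩)⟩
  refine ⟨fun k => (hsupp k).1, ?_, fun k => ?_, fun k => ?_⟩
  · rw [hν0, Measure.map_map measurable_fst hdiag, Measure.map_map measurable_snd hdiag]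
    rfl
  · have := (hsupp k).1
    rw [hstep k (hsupp k).2, Measure.map_map measurable_fst hΦ]
    conv_rhs => rw [← Measure.map_id (μ := _root_.stdGaussian d)]
    rw [Measure.map_prod_map _ _ measurable_fst measurable_id,
      Measure.map_map (by fun_prop) (by fun_prop)]
    rfl
  · have := (hsupp k).1
    rw [hstep k (hsupp k).2, Measure.map_map measurable_snd hΦ]
    conv_rhs => rw [← Measure.map_id (μ := _root_.stdGaussian d)]
    rw [Measure.map_prod_map _ _ measurable_snd measurable_id,
      Measure.map_map (by fun_prop) (by fun_prop)]
    rfl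

section MeanLoss

variable {X : Type*} {n : ℕ} {ℓ : EuclideanSpace ℝ (Fin d) → X → ℝ}
  {C : Set (EuclideanSpace ℝ (Fin d))} {lam β : ℝ}

lemma mean_strongly_convex (hn : 1 ≤ n)
    (hsc : ∀ x : X, ∀ θ ∈ C, ∀ θ' ∈ C,
      ℓ θ' x ≥ ℓ θ x + ⟪gradient (fun w => ℓ w x) θ, θ' - θ⟫ + lam / 2 * ‖θ' - θ‖ ^ 2)
    (A : Fin n → X) (x : EuclideanSpace ℝ (Fin d)) (hx : x ∈ C) (y : EuclideanSpace ℝ (Fin d))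
    (hy : y ∈ C) :
    (n : ℝ)⁻¹ * ∑ i, ℓ x (A i) + ⟪(n : ℝ)⁻¹ • ∑ i, gradient (fun w => ℓ w (A i)) x, y - x⟫
      + lam / 2 * ‖y - x‖ ^ 2 ≤ (n : ℝ)⁻¹ * ∑ i, ℓ y (A i) := by
  have hn0 : (0 : ℝ) < n := by exact_mod_cast hn
  have h := Finset.sum_le_sum fun i (_ : i ∈ Finset.univ) => hsc (A i) x hx y hy
  rw [Finset.sum_add_distrib, Finset.sum_add_distrib, Finset.sum_const, Finset.card_univ,
    Fintype.card_fin, nsmul_eq_mul, ← sum_inner] at h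
  rw [real_inner_smul_left]
  calc _ = (n : ℝ)⁻¹ * (∑ i, ℓ x (A i) + ⟪∑ i, gradient (fun w => ℓ w (A i)) x, y - x⟫
        + n * (lam / 2 * ‖y - x‖ ^ 2)) := by
        field_simp
    _ ≤ _ := by gcongr

lemma mean_smooth (hn : 1 ≤ n)
    (hsm : ∀ x : X, ∀ θ ∈ C, ∀ θ' ∈ C,
      ‖gradient (fun w => ℓ w x) θ - gradient (fun w => ℓ w x) θ'‖ ≤ β * ‖θ - θ'‖)
    (A : Fin n → X) (x : EuclideanSpace ℝ (Fin d)) (hx : x ∈ C) (y : EuclideanSpace ℝ (Fin d))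
    (hy : y ∈ C) :
    ‖(n : ℝ)⁻¹ • ∑ i, gradient (fun w => ℓ w (A i)) x
      - (n : ℝ)⁻¹ • ∑ i, gradient (fun w => ℓ w (A i)) y‖ ≤ β * ‖x - y‖ := by
  have hn0 : (0 : ℝ) < n := by exact_mod_cast hn
  rw [← smul_sub, ← Finset.sum_sub_distrib, norm_smul, Real.norm_of_nonneg (by positivity),
    inv_mul_le_iff₀ hn0]
  refine (norm_sum_le_of_le _ fun i _ => hsm (A i) x hx y hy).trans (le_of_eq ?_)
  simp

lemma strong_convexity_le_smoothness (x₀ : X)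
    (hsc : ∀ x : X, ∀ θ ∈ C, ∀ θ' ∈ C,
      ℓ θ' x ≥ ℓ θ x + ⟪gradient (fun w => ℓ w x) θ, θ' - θ⟫ + lam / 2 * ‖θ' - θ‖ ^ 2)
    (hsm : ∀ x : X, ∀ θ ∈ C, ∀ θ' ∈ C,
      ‖gradient (fun w => ℓ w x) θ - gradient (fun w => ℓ w x) θ'‖ ≤ β * ‖θ - θ'‖)
    (hC : C.Nontrivial) : lam ≤ β := by
  obtain ⟨a, ha, b, hb, hab⟩ := hC
  have h1 := hsc x₀ a ha b hb
  have h2 := hsc x₀ b hb a ha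
  have h3 := (real_inner_le_norm (gradient (fun w => ℓ w x₀) a - gradient (fun w => ℓ w x₀) b)
    (a - b)).trans (mul_le_mul_of_nonneg_right (hsm x₀ a ha b hb) (norm_nonneg _))
  rw [← neg_sub a b, inner_neg_right, norm_neg] at h1
  rw [inner_sub_left] at h3
  have hpos : 0 < ‖a - b‖ := norm_pos_iff.2 (sub_ne_zero.2 hab)
  have h4 : lam * ‖a - b‖ ^ 2 ≤ β * ‖a - b‖ ^ 2 := by nlinarith
  exact le_of_mul_le_mul_right h4 (by positivity)

end MeanLoss

/-- Privacy guarantee for noisy GD.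
For a `λ`-strongly convex, `β`-smooth loss on a closed convex set `C` with total gradient
sensitivity `S_g`, step size `0 < η < 1/β`, the coupled noisy GD chains on neighboring
datasets `D, D'` started from `Proj_C(N(0, (2σ²/λ)I_d))` satisfy
`R_α(θ_K‖θ'_K) ≤ (α S_g²/(λσ²n²))(1 − e^{−ληK/2})`, i.e. `(α, ε)`-RDP. -/
theorem noisy_gd_rdp
    {X : Type*} (n : ℕ) (hn : 1 ≤ n)
    (ℓ : 𝓔 → X → ℝ) (lam β η σ Sg α : ℝ) (K : ℕ)
    (hlam : 0 < lam) (hβ : 0 < β) (hη : 0 < η) (hηβ : η < 1 / β) (hσ : 0 < σ) (hα : 1 < α)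
    (C : Set 𝓔) (hCne : C.Nonempty) (hCclosed : IsClosed C) (hCconvex : Convex ℝ C)
    -- `λ`-strong convexity and `β`-smoothness of the loss in `θ` on `C`
    (hsc : ∀ x : X, ∀ θ ∈ C, ∀ θ' ∈ C,
      ℓ θ' x ≥ ℓ θ x + ⟪gradient (fun w => ℓ w x) θ, θ' - θ⟫ + lam / 2 * ‖θ' - θ‖ ^ 2)
    (hsm : ∀ x : X, ∀ θ ∈ C, ∀ θ' ∈ C,
      ‖gradient (fun w => ℓ w x) θ - gradient (fun w => ℓ w x) θ'‖ ≤ β * ‖θ - θ'‖)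
    -- total gradient sensitivity `S_g` over neighboring datasets
    (hsens : ∀ A B : Fin n → X, Neighboring A B → ∀ θ : 𝓔,
      ‖(∑ i, gradient (fun w => ℓ w (A i)) θ) - ∑ i, gradient (fun w => ℓ w (B i)) θ‖ ≤ Sg)
    -- the neighboring datasets
    (D D' : Fin n → X) (hDD' : Neighboring D D')
    -- `projC` is the nearest-point projection onto `C`
    (projC : 𝓔 → 𝓔)
    (hproj : ∀ θ : 𝓔, projC θ ∈ C ∧ ∀ y ∈ C, ‖θ - projC θ‖ ≤ ‖θ - y‖)
    -- the coupled noisy GD chains (same Gaussian noise in both coordinates)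
    (ν : ℕ → Measure (𝓔 × 𝓔))
    (hν0 : ν 0 = Measure.map (fun w : 𝓔 => (projC w, projC w))
      (Measure.map (fun z => Real.sqrt (2 * σ ^ 2 / lam) • z) (stdGaussian d)))
    (hrec : ∀ k : ℕ, ν (k + 1) = Measure.map
      (fun q : (𝓔 × 𝓔) × 𝓔 =>
        (projC (q.1.1 - (η / n) • (∑ i, gradient (fun w => ℓ w (D i)) q.1.1)
            + Real.sqrt (2 * η * σ ^ 2) • q.2),
         projC (q.1.2 - (η / n) • (∑ i, gradient (fun w => ℓ w (D' i)) q.1.2)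
            + Real.sqrt (2 * η * σ ^ 2) • q.2)))
      ((ν k).prod (stdGaussian d))) :
    renyiDiv α (Measure.map Prod.fst (ν K)) (Measure.map Prod.snd (ν K))
      ≤ α * Sg ^ 2 / (lam * σ ^ 2 * n ^ 2) * (1 - Real.exp (-(lam * η * K) / 2)) := by
  have hn0 : (0 : ℝ) < n := by exact_mod_cast hn
  have hτ : 0 < Real.sqrt (2 * η * σ ^ 2) := Real.sqrt_pos.2 (by positivity)
  have hprojm : Measurable projC := (LipschitzWith.of_dist_le_mul (K := 1) fun x y => by
    simpa [dist_eq_norm] using norm_nearest_sub_le hCconvex hproj x y).continuous.measurable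
  have hμ₀ : IsProbabilityMeasure (Measure.map
      (fun z : 𝓔 => Real.sqrt (2 * σ ^ 2 / lam) • z) (_root_.stdGaussian d)) :=
    Measure.isProbabilityMeasure_map (by fun_prop)
  rcases C.subsingleton_or_nontrivial with hC | hC
  · have hconst : ∀ x y, projC x = projC y := fun x y => hC (hproj x).1 (hproj y).1
    obtain ⟨hprob, h0, h1, h2⟩ := coupled_chain_marginals (τ := Real.sqrt (2 * η * σ ^ 2))
      (F := fun x => x - (η / n) • (∑ i, gradient (fun w => ℓ w (D i)) x))
      (F' := fun x => x - (η / n) • (∑ i, gradient (fun w => ℓ w (D' i)) x))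
      (T := fun _ => 0) (T' := fun _ => 0) hCclosed.measurableSet hprojm (fun θ => (hproj θ).1) measurable_const measurable_const
      (fun _ _ _ => hconst _ _) (fun _ _ _ => hconst _ _) hν0 hrec
    have hp0 := hprob 0
    have : IsProbabilityMeasure (Measure.map Prod.fst (ν 0)) :=
      Measure.isProbabilityMeasure_map measurable_fst.aemeasurable
    have h := renyiDiv_noisy_iteration_le (c := 0) (s := 0)
      (μ := fun k => Measure.map Prod.fst (ν k)) (μ' := fun k => Measure.map Prod.snd (ν k))
      hα hτ measurable_const measurable_const
      hprojm (norm_nearest_sub_le hCconvex hproj) le_rfl le_rfl (by simp) h0 h1 h2 K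
      (w := fun _ => 0) (fun _ _ => le_rfl) rfl (fun _ _ => by simp)
    refine h.trans ?_
    have hexp : Real.exp (-(lam * η * K) / 2) ≤ 1 := Real.exp_le_one_iff.2 (by
      have : 0 ≤ lam * η * K := by positivity
      linarith)
    simp only [mul_zero, add_zero, sub_zero, ne_eq, OfNat.ofNat_ne_zero, not_false_eq_true,
      zero_pow, zero_div, Finset.sum_const_zero]
    exact mul_nonneg (by positivity) (by linarith)
  · have hηβ' : η * β < 1 := by rwa [lt_div_iff₀ hβ] at hηβ
    have hηlam : η * lam < 1 := lt_of_le_of_lt (mul_le_mul_of_nonneg_left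
      (strong_convexity_le_smoothness (D ⟨0, hn⟩) hsc hsm hC) hη.le) hηβ'
    have hηlam0 : 0 < η * lam := by positivity
    have hSg : 0 ≤ Sg := (norm_nonneg _).trans (hsens D D' hDD' 0)
    set g : (Fin n → X) → 𝓔 → 𝓔 :=
      fun A θ => (n : ℝ)⁻¹ • ∑ i, gradient (fun w => ℓ w (A i)) θ with hg
    have hcontr : ∀ A : Fin n → X, ∀ x y, ‖tangentStep C projC η (g A) x
        - tangentStep C projC η (g A) y‖ ≤ (1 - η * lam) * ‖x - y‖ := fun A =>
      norm_tangentStep_sub_le hCconvex hproj hlam.le hη hηlam hηβ'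
        (f := fun θ => (n : ℝ)⁻¹ * ∑ i, ℓ θ (A i))
        (mean_strongly_convex hn hsc A) (mean_smooth hn hsm A)
    have hmeas : ∀ A : Fin n → X, Measurable (tangentStep C projC η (g A)) := fun A =>
      (LipschitzWith.of_dist_le' fun x y => by
        simpa only [dist_eq_norm] using hcontr A x y).continuous.measurable
    have hstep : ∀ A : Fin n → X, ∀ x ∈ C, ∀ z,
        projC (x - (η / n) • (∑ i, gradient (fun w => ℓ w (A i)) x) + z)
          = projC (tangentStep C projC η (g A) x + z) := by
      intro A x hx z
      rw [← nearest_sub_smul_add_eq hCconvex hproj η (g A) hx z, hg, smul_smul, div_eq_mul_inv]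
    have hdiff : ∀ x y, ‖tangentStep C projC η (g D) x - tangentStep C projC η (g D') y‖
        ≤ (1 - η * lam) * ‖x - y‖ + η * ((n : ℝ)⁻¹ * Sg) := by
      intro x y
      refine (norm_sub_le_norm_sub_add_norm_sub _ (tangentStep C projC η (g D) y) _).trans
        (add_le_add (hcontr D x y) (norm_tangentStep_sub_tangentStep_le hη.le y ?_))
      rw [hg, ← smul_sub, norm_smul, Real.norm_of_nonneg (by positivity)]
      gcongr
      exact hsens D D' hDD' _
    obtain ⟨hprob, h0, h1, h2⟩ := coupled_chain_marginals hCclosed.measurableSet hprojm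
      (fun θ => (hproj θ).1) (hmeas D) (hmeas D') (hstep D) (hstep D') hν0 hrec
    have hp0 := hprob 0
    have : IsProbabilityMeasure (Measure.map Prod.fst (ν 0)) :=
      Measure.isProbabilityMeasure_map measurable_fst.aemeasurable
    obtain ⟨w, hw0, hwK, hwstep, hwsum⟩ :=
      exists_shift_schedule (c := 1 - η * lam) (by linarith) (by linarith) K
    set s := η * ((n : ℝ)⁻¹ * Sg) with hs
    have hs0 : 0 ≤ s := by positivity
    have h := renyiDiv_noisy_iteration_le
      (μ := fun k => Measure.map Prod.fst (ν k)) (μ' := fun k => Measure.map Prod.snd (ν k))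
      hα hτ (hmeas D) (hmeas D') hprojm (norm_nearest_sub_le hCconvex hproj) (by linarith) hs0
      hdiff h0 h1 h2 K (w := fun k => s * w k) (fun k hk => mul_nonneg hs0 (hw0 k hk))
      (by simp [hwK]) (fun k hk => by nlinarith [hwstep k hk])
    refine h.trans ?_
    have hsum : ∑ k ∈ Finset.range K, ((1 - η * lam) * (s * w k) + s - s * w (k + 1)) ^ 2
          / (2 * Real.sqrt (2 * η * σ ^ 2) ^ 2)
        = s ^ 2 / (4 * η * σ ^ 2)
          * ∑ k ∈ Finset.range K, ((1 - η * lam) * w k + 1 - w (k + 1)) ^ 2 := by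
      rw [Finset.mul_sum, Real.sq_sqrt (by positivity)]
      refine Finset.sum_congr rfl fun k _ => ?_
      field_simp
      ring
    rw [hsum]
    calc _ ≤ α * (s ^ 2 / (4 * η * σ ^ 2) * (4 / (1 - (1 - η * lam))
          * (1 - Real.exp (-((1 - (1 - η * lam)) * K / 2))))) := by gcongr
      _ = _ := by
        rw [sub_sub_cancel, hs, show -(η * lam * K / 2) = -(lam * η * K) / 2 by ring]
        field_simp

end
end

section
/- Consider the loss function ℓ(θ;x) = (1/2)‖θ − x‖² on ℝ^d with data domain {x ∈ ℝ^d : ‖x‖ ≤ S_g/2}. Let x₁, x₁' ∈ ℝ^d satisfy ‖x₁‖ = ‖x₁'‖ = S_g/2 and ‖x₁ − x₁'‖ = S_g, and let D = (x₁, 0, …, 0) and D' = (x₁', 0, …, 0) be datasets of size n. For 0 < η < 1, σ > 0, and initial parameter θ₀ = 0 ∈ ℝ^d, run the (unconstrained, C = ℝ^d) noisy gradient descent chains θ_{k+1} = (1−η)θ_k + η·(x₁/n) + √(2ησ²)·Z_k and θ'_{k+1} = (1−η)θ'_k + η·(x₁'/n) + √(2ησ²)·Z_k with Z_k i.i.d.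 standard Gaussians on ℝ^d. Then for every K ∈ ℕ with K ≥ 1 and every α > 1, the α-Rényi divergence between the laws of θ_K and θ'_K satisfies R_α(θ_K‖θ'_K) ≥ (α·S_g²/(4σ²·n²))·(1 − e^{−ηK}). -/
open MeasureTheory ProbabilityTheory Real

noncomputable section

variable {d : ℕ}

local notation "𝓔" => EuclideanSpace ℝ (Fin d)

section GaussianShift

variable {E : Type*} [NormedAddCommGroup E] [InnerProductSpace ℝ E] [FiniteDimensional ℝ E]
  [MeasurableSpace E] [BorelSpace E]

lemma map_inner_stdGaussian (u : E) :
    (ProbabilityTheory.stdGaussian E).map (fun x ↦ inner ℝ u x)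
      = gaussianReal 0 (‖u‖ ^ 2).toNNReal := by
  have h := IsGaussian.map_eq_gaussianReal (μ := ProbabilityTheory.stdGaussian E)
    (innerSL ℝ u)
  rwa [integral_strongDual_stdGaussian, variance_dual_stdGaussian, innerSL_apply_norm] at h

lemma mgf_inner_stdGaussian (u : E) (r : ℝ) :
    mgf (fun x ↦ inner ℝ u x) (ProbabilityTheory.stdGaussian E) r
      = exp (r ^ 2 * ‖u‖ ^ 2 / 2) := by
  rw [mgf_gaussianReal (map_inner_stdGaussian u), Real.coe_toNNReal _ (by positivity)]
  ring_nf

lemma integral_exp_inner_stdGaussian (u : E) :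
    ∫ x, exp (inner ℝ u x) ∂(ProbabilityTheory.stdGaussian E) = exp (‖u‖ ^ 2 / 2) := by
  simpa [mgf] using mgf_inner_stdGaussian u 1

lemma integrable_exp_inner_stdGaussian (u : E) :
    Integrable (fun x ↦ exp (inner ℝ u x)) (ProbabilityTheory.stdGaussian E) := by
  by_contra h
  have h' := integral_exp_inner_stdGaussian u
  rw [integral_undef h] at h'
  exact (exp_pos _).ne h'

/-- The Cameron–Martin formula: tilting a standard Gaussian by a linear form translates it. -/
lemma tilted_inner_stdGaussian (u : E) :
    (ProbabilityTheory.stdGaussian E).tilted (fun x ↦ inner ℝ u x)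
      = (ProbabilityTheory.stdGaussian E).map (· + u) := by
  have hprob := isProbabilityMeasure_tilted (integrable_exp_inner_stdGaussian u)
  refine Measure.ext_of_charFun (funext fun t ↦ ?_)
  set v := (‖t‖ ^ 2).toNNReal with hv
  have hv' : (v : ℝ) = ‖t‖ ^ 2 := Real.coe_toNNReal _ (by positivity)
  have hmgf : mgf id (gaussianReal (inner ℝ t u) v)
      = mgf (fun x ↦ inner ℝ t x)
        ((ProbabilityTheory.stdGaussian E).tilted (fun x ↦ inner ℝ u x)) := by
    ext r
    have hadd : ∀ x : E, ((fun x : E ↦ inner ℝ u x) + fun x : E ↦ r * inner ℝ t x) x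
        = inner ℝ (u + r • t) x := fun x ↦ by
      simp [inner_add_left, inner_smul_left]
    rw [mgf_id_gaussianReal, mgf, integral_exp_tilted, integral_exp_inner_stdGaussian]
    simp_rw [hadd]
    rw [integral_exp_inner_stdGaussian, ← exp_sub, hv', norm_add_sq_real, inner_smul_right,
      norm_smul, real_inner_comm, mul_pow, Real.norm_eq_abs, sq_abs]
    ring_nf
  have hI := eqOn_complexMGF_of_mgf hmgf (x := Complex.I) (by simp)
  rw [complexMGF_id_gaussianReal, complexMGF] at hI
  rw [charFun_map_add_const, charFun_stdGaussian, charFun_apply]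
  have hcomm : ∀ x : E, Complex.exp ((inner ℝ x t : ℝ) * Complex.I)
      = Complex.exp (Complex.I * (inner ℝ t x : ℝ)) := fun x ↦ by
    rw [real_inner_comm, mul_comm]
  simp_rw [hcomm]
  rw [← hI, ← Complex.exp_add, Complex.I_sq, real_inner_comm]
  have : (v : ℂ) = (‖t‖ : ℂ) ^ 2 := by exact_mod_cast congrArg Complex.ofReal hv'
  rw [this]
  ring_nf

end GaussianShift

/-- The Rényi divergence between two isotropic Gaussians with the same covariance. -/
lemma renyiDiv_map_affine_stdGaussian {α s : ℝ} (hα : α ≠ 1) (hs : s ≠ 0) (m m' : 𝓔) :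
    renyiDiv α ((ProbabilityTheory.stdGaussian 𝓔).map (fun z ↦ m + s • z))
      ((ProbabilityTheory.stdGaussian 𝓔).map (fun z ↦ m' + s • z))
      = α * ‖m - m'‖ ^ 2 / (2 * s ^ 2) := by
  set γ := ProbabilityTheory.stdGaussian 𝓔
  set u : 𝓔 := s⁻¹ • (m - m') with hu
  let e : 𝓔 ≃ₜ 𝓔 := (Homeomorph.smulOfNeZero s hs).trans (Homeomorph.addLeft m')
  have hemb : MeasurableEmbedding (fun z : 𝓔 ↦ m' + s • z) := e.measurableEmbedding
  have hm : γ.map (fun z ↦ m + s • z)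
      = (γ.tilted (fun x ↦ inner ℝ u x)).map (fun z ↦ m' + s • z) := by
    rw [tilted_inner_stdGaussian, Measure.map_map (by fun_prop) (by fun_prop)]
    congr 1
    ext1 z
    simp only [Function.comp_apply, smul_add, hu, smul_smul, mul_inv_cancel₀ hs, one_smul]
    abel
  have hprob := isProbabilityMeasure_tilted (integrable_exp_inner_stdGaussian u)
  have hint : ∫ θ, (((γ.map (fun z ↦ m + s • z)).rnDeriv
      (γ.map (fun z ↦ m' + s • z)) θ).toReal) ^ α ∂(γ.map (fun z ↦ m' + s • z))
      = exp (α * (α - 1) * ‖u‖ ^ 2 / 2) := by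
    rw [hm, hemb.integral_map]
    have hae : (fun x ↦ (((γ.tilted fun x ↦ inner ℝ u x).map (fun z ↦ m' + s • z)).rnDeriv
        (γ.map (fun z ↦ m' + s • z)) (m' + s • x)).toReal ^ α) =ᵐ[γ]
        fun x ↦ exp (inner ℝ (α • u) x) * exp (-(α * ‖u‖ ^ 2 / 2)) := by
      filter_upwards [hemb.rnDeriv_map (γ.tilted fun x ↦ inner ℝ u x) γ,
        rnDeriv_tilted_left_self (μ := γ) (f := fun x ↦ inner ℝ u x) (by fun_prop)] with x h1 h2
      rw [h1, h2, integral_exp_inner_stdGaussian, ← exp_sub, ENNReal.toReal_ofReal (exp_pos _).le,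
        ← exp_mul, ← exp_add, real_inner_smul_left u x α]
      congr 1
      ring
    rw [integral_congr_ae hae, integral_mul_const, integral_exp_inner_stdGaussian, ← exp_add,
      norm_smul, mul_pow, Real.norm_eq_abs, sq_abs]
    ring_nf
  rw [renyiDiv, hint, log_exp, hu, norm_smul, mul_pow, Real.norm_eq_abs, sq_abs]
  have : α - 1 ≠ 0 := sub_ne_zero.mpr hα
  field_simp

lemma stdGaussian_eq_probabilityTheory_stdGaussian (d : ℕ) :
    _root_.stdGaussian d = ProbabilityTheory.stdGaussian (EuclideanSpace ℝ (Fin d)) :=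
  map_pi_eq_stdGaussian

/-- The law after `k` steps of the linear recursion `θ ↦ q • θ + c + τ • Z`, started at `0` and
driven by standard Gaussian noise. -/
lemma eq_map_affine_stdGaussian_of_rec {q τ : ℝ} (hq : 0 ≤ q) (hq1 : q < 1) (c : 𝓔)
    (μ : ℕ → Measure 𝓔) (h0 : μ 0 = Measure.dirac 0)
    (hrec : ∀ k, μ (k + 1) = ((μ k).prod (ProbabilityTheory.stdGaussian 𝓔)).map
      (fun p ↦ q • p.1 + c + τ • p.2)) (k : ℕ) :
    μ k = (ProbabilityTheory.stdGaussian 𝓔).map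
      (fun z ↦ ((1 - q ^ k) / (1 - q)) • c
        + √(τ ^ 2 * ((1 - q ^ (2 * k)) / (1 - q ^ 2))) • z) := by
  have hq2 : 0 < 1 - q ^ 2 := by nlinarith
  induction k with
  | zero => simp [h0]
  | succ k ih =>
    rw [hrec, ih]
    set γ := ProbabilityTheory.stdGaussian 𝓔
    have hV : ∀ j : ℕ, 0 ≤ τ ^ 2 * ((1 - q ^ (2 * j)) / (1 - q ^ 2)) := fun j ↦ by
      have : q ^ (2 * j) ≤ 1 := pow_le_one₀ hq hq1.le
      have : 0 ≤ 1 - q ^ (2 * j) := by linarith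
      positivity
    have haff : ∀ (a : 𝓔) (b : ℝ) (t : 𝓔), charFun (γ.map (fun z ↦ a + b • z)) t
        = Complex.exp ((inner ℝ a t : ℝ) * Complex.I - (b ^ 2 : ℝ) * ‖t‖ ^ 2 / 2) := by
      intro a b t
      have : γ.map (fun z ↦ a + b • z) = (γ.map (b • ·)).map (a + ·) := by
        rw [Measure.map_map (by fun_prop) (by fun_prop)]; rfl
      rw [this, charFun_map_const_add, charFun_map_smul, charFun_stdGaussian, norm_smul,
        ← Complex.exp_add]
      congr 1
      have : ((‖b‖ * ‖t‖ : ℝ) : ℂ) ^ 2 = (b ^ 2 : ℝ) * (‖t‖ : ℂ) ^ 2 := by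
        rw [← Complex.ofReal_pow, mul_pow, Real.norm_eq_abs, sq_abs]; push_cast; ring
      rw [this]
      ring
    have hsplit : ∀ (a : 𝓔) (b : ℝ), ((γ.map (fun z ↦ a + b • z)).prod γ).map
        (fun p ↦ q • p.1 + c + τ • p.2)
        = ((γ.map (fun z ↦ (q • a + c) + (q * b) • z)).prod
          (γ.map (fun z ↦ (0 : 𝓔) + τ • z))).map (fun p ↦ p.1 + p.2) := by
      intro a b
      have h1 : (γ.map (fun z ↦ a + b • z)).prod γ
          = (γ.prod γ).map (Prod.map (fun z ↦ a + b • z) id) := by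
        rw [← Measure.map_prod_map _ _ (by fun_prop) (by fun_prop), Measure.map_id]
      rw [h1, Measure.map_prod_map _ _ (by fun_prop) (by fun_prop),
        Measure.map_map (by fun_prop) (by fun_prop), Measure.map_map (by fun_prop) (by fun_prop)]
      congr 1
      ext1 p
      simp only [Function.comp_apply, Prod.map_fst, Prod.map_snd, id, smul_add, smul_smul, zero_add]
      abel
    have hP : ∀ (a : 𝓔) (b : ℝ), IsProbabilityMeasure (γ.map (fun z ↦ a + b • z)) :=
      fun a b ↦ Measure.isProbabilityMeasure_map (by fun_prop)
    rw [hsplit]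
    have : IsProbabilityMeasure (γ.map (fun z ↦ (0 : 𝓔) + τ • z)) := hP 0 τ
    refine Measure.ext_of_charFun (funext fun t ↦ ?_)
    rw [charFun_map_add_prod_eq_mul, Pi.mul_apply, haff, haff, haff, ← Complex.exp_add,
      mul_pow, sq_sqrt (hV k), sq_sqrt (hV (k + 1))]
    have hmean : q • ((1 - q ^ k) / (1 - q)) • c + c = ((1 - q ^ (k + 1)) / (1 - q)) • c := by
      have : 1 - q ≠ 0 := (sub_pos.mpr hq1).ne'
      rw [smul_smul]
      nth_rw 2 [← one_smul ℝ c]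
      rw [← add_smul]
      congr 1
      field_simp
      ring
    have hvar : q ^ 2 * (τ ^ 2 * ((1 - q ^ (2 * k)) / (1 - q ^ 2))) + τ ^ 2
        = τ ^ 2 * ((1 - q ^ (2 * (k + 1))) / (1 - q ^ 2)) := by
      field_simp
      ring
    rw [hmean, ← hvar, inner_zero_left]
    congr 1
    push_cast
    ring

lemma one_sub_exp_le_of_pow {η : ℝ} (hη : 0 < η) (hη1 : η < 1) {K : ℕ} (hK : 1 ≤ K) :
    1 - exp (-(η * K)) ≤ (2 - η) * (1 - (1 - η) ^ K) / (1 + (1 - η) ^ K) := by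
  have hq : 0 < 1 - η := by linarith
  have hpow : (1 - η) ^ K ≤ exp (-(η * K)) := by
    calc (1 - η) ^ K ≤ exp (-η) ^ K := pow_le_pow_left₀ hq.le (one_sub_le_exp_neg η) K
      _ = exp (-(η * K)) := by rw [← exp_nat_mul]; ring_nf
  have hpow1 : (1 - η) ^ K ≤ 1 - η := pow_le_of_le_one hq.le (by linarith) (by omega)
  have hpos : 0 < (1 - η) ^ K := by positivity
  rw [le_div_iff₀ (by positivity)]
  nlinarith

/-- Theorem: lower bound on the RDP of noisy GD.
For the squared-norm loss `ℓ(θ;x) = ½‖θ − x‖²` on the datasets `D = (x₁, 0, …, 0)` and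
`D' = (x₁', 0, …, 0)` with `‖x₁‖ = ‖x₁'‖ = S_g/2` and `‖x₁ − x₁'‖ = S_g`, the unconstrained
noisy GD chains started at `θ₀ = 0` satisfy
`R_α(θ_K‖θ'_K) ≥ (α S_g²/(4σ²n²))(1 − e^{−ηK})` for every `K ≥ 1` and `α > 1`. -/
theorem noisy_gd_rdp_lower_bound
    (n : ℕ) (hn : 1 ≤ n) (Sg η σ α : ℝ) (K : ℕ)
    (hη : 0 < η) (hη1 : η < 1) (hσ : 0 < σ) (hα : 1 < α) (hK : 1 ≤ K)
    (x₁ x₁' : 𝓔)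
    (hx₁ : ‖x₁‖ = Sg / 2) (hx₁' : ‖x₁'‖ = Sg / 2) (hdiff : ‖x₁ - x₁'‖ = Sg)
    -- the coupled unconstrained noisy GD chains on `D = (x₁,0,…,0)`, `D' = (x₁',0,…,0)`,
    -- started from `θ₀ = θ'₀ = 0`, with the same Gaussian noise in both coordinates
    (ν : ℕ → Measure (𝓔 × 𝓔))
    (hν0 : ν 0 = Measure.dirac (0, 0))
    (hrec : ∀ k : ℕ, ν (k + 1) = Measure.map
      (fun q : (𝓔 × 𝓔) × 𝓔 =>
        ((1 - η) • q.1.1 + (η / n) • x₁ + Real.sqrt (2 * η * σ ^ 2) • q.2,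
         (1 - η) • q.1.2 + (η / n) • x₁' + Real.sqrt (2 * η * σ ^ 2) • q.2))
      ((ν k).prod (stdGaussian d))) :
    α * Sg ^ 2 / (4 * σ ^ 2 * n ^ 2) * (1 - Real.exp (-(η * K)))
      ≤ renyiDiv α (Measure.map Prod.fst (ν K)) (Measure.map Prod.snd (ν K)) := by
  have hprob : ∀ k, IsProbabilityMeasure (ν k) := by
    intro k
    induction k with
    | zero => rw [hν0]; infer_instance
    | succ k ih =>
      rw [hrec, stdGaussian_eq_probabilityTheory_stdGaussian]
      exact Measure.isProbabilityMeasure_map (by fun_prop)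
  have hfst := eq_map_affine_stdGaussian_of_rec (q := 1 - η) (τ := √(2 * η * σ ^ 2))
    (by linarith) (by linarith) ((η / n) • x₁) (fun k ↦ (ν k).map Prod.fst)
    (by simp [hν0, Measure.map_dirac]) (fun k ↦ by
      simp only [hrec, stdGaussian_eq_probabilityTheory_stdGaussian]
      nth_rw 2 [← Measure.map_id (μ := ProbabilityTheory.stdGaussian 𝓔)]
      rw [Measure.map_prod_map _ _ (by fun_prop) (by fun_prop),
        Measure.map_map (by fun_prop) (by fun_prop), Measure.map_map (by fun_prop) (by fun_prop)]
      rfl) K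
  have hsnd := eq_map_affine_stdGaussian_of_rec (q := 1 - η) (τ := √(2 * η * σ ^ 2))
    (by linarith) (by linarith) ((η / n) • x₁') (fun k ↦ (ν k).map Prod.snd)
    (by simp [hν0, Measure.map_dirac]) (fun k ↦ by
      simp only [hrec, stdGaussian_eq_probabilityTheory_stdGaussian]
      nth_rw 2 [← Measure.map_id (μ := ProbabilityTheory.stdGaussian 𝓔)]
      rw [Measure.map_prod_map _ _ (by fun_prop) (by fun_prop),
        Measure.map_map (by fun_prop) (by fun_prop), Measure.map_map (by fun_prop) (by fun_prop)]
      rfl) K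
  simp only at hfst hsnd
  have hQ0 : 0 < (1 - η) ^ K := pow_pos (by linarith) K
  have hQ1 : (1 - η) ^ K < 1 := pow_lt_one₀ (by linarith) (by linarith) (by omega)
  have hn0 : (0 : ℝ) < n := by exact_mod_cast hn
  have hV : √(2 * η * σ ^ 2) ^ 2 * ((1 - (1 - η) ^ (2 * K)) / (1 - (1 - η) ^ 2))
      = 2 * σ ^ 2 * (1 - (1 - η) ^ K) * (1 + (1 - η) ^ K) / (2 - η) := by
    rw [sq_sqrt (by positivity), mul_comm 2 K, pow_mul,
      show 1 - (1 - η) ^ 2 = η * (2 - η) by ring]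
    have : 2 - η ≠ 0 := by linarith
    field_simp
    ring
  have hVpos : 0 < 2 * σ ^ 2 * (1 - (1 - η) ^ K) * (1 + (1 - η) ^ K) / (2 - η) := by
    have h1 : 0 < 1 - (1 - η) ^ K := by linarith
    have h2 : 0 < 2 - η := by linarith
    positivity
  rw [hV] at hfst hsnd
  rw [hfst, hsnd, renyiDiv_map_affine_stdGaussian hα.ne' (sqrt_pos.mpr hVpos).ne',
    ← smul_sub, ← smul_sub, norm_smul, norm_smul, hdiff, sq_sqrt hVpos.le, mul_pow, mul_pow,
    Real.norm_eq_abs, Real.norm_eq_abs, sq_abs, sq_abs, sub_sub_cancel]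
  calc α * Sg ^ 2 / (4 * σ ^ 2 * n ^ 2) * (1 - exp (-(η * K)))
      ≤ α * Sg ^ 2 / (4 * σ ^ 2 * n ^ 2)
        * ((2 - η) * (1 - (1 - η) ^ K) / (1 + (1 - η) ^ K)) :=
        mul_le_mul_of_nonneg_left (one_sub_exp_le_of_pow hη hη1 hK) (by positivity)
    _ = _ := by
      have h1 : 1 - (1 - η) ^ K ≠ 0 := by linarith
      have h2 : 2 - η ≠ 0 := by linarith
      field_simp
      norm_num
end
end

section
/- Let 0 < η < 1, σ̃ > 0, μ, μ' ∈ ℝ^d, and K ∈ ℕ with K ≥ 1. Define two Markov chains on ℝ^d by θ₀ = θ'₀ = 0, θ_{k+1} = (1−η)θ_k + ημ + √(2ησ̃²)·Z_k and θ'_{k+1} = (1−η)θ'_k + ημ' + √(2ησ̃²)·Z_k, with Z_k i.i.d. standard Gaussians on ℝ^d. Then the law of θ_K is the Gaussian N(ημ·∑_{i=0}^{K−1}(1−η)^i, 2ησ̃²·∑_{i=0}^{K−1}(1−η)^{2i}·I_d) (and similarly for θ'_K with mean ημ'·∑_{i=0}^{K−1}(1−η)^i), and for every α > 1 the α-Rényi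 divergence between the two laws equals R_α(θ_K‖θ'_K) = (α·‖μ − μ'‖²/(4σ̃²))·((2−η)/(1+(1−η)^K))·(1 − (1−η)^K). -/
open MeasureTheory ProbabilityTheory Real

noncomputable section

variable {d : ℕ}

local notation "𝓔" => EuclideanSpace ℝ (Fin d)

/-- The isotropic Gaussian measure `N(b, v • I_d)` on `ℝ^d`. -/
def isoGaussian (b : 𝓔) (v : ℝ) : Measure 𝓔 :=
  Measure.map (fun z : 𝓔 => b + Real.sqrt v • z) (stdGaussian d)

instance isProbabilityMeasure_stdGaussian : IsProbabilityMeasure (stdGaussian d) :=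
  Measure.isProbabilityMeasure_map (by fun_prop)

instance isProbabilityMeasure_isoGaussian (b : 𝓔) (v : ℝ) :
    IsProbabilityMeasure (isoGaussian b v) :=
  Measure.isProbabilityMeasure_map (by fun_prop)

theorem integral_cexp_stdGaussian (w : Fin d → ℂ) :
    ∫ z, Complex.exp (∑ i, w i * z i) ∂(stdGaussian d) = Complex.exp (∑ i, w i ^ 2 / 2) := by
  rw [_root_.stdGaussian, integral_map (by fun_prop) (by fun_prop)]
  have h (i : Fin d) : ∫ x, Complex.exp (w i * x) ∂(gaussianReal 0 1)
      = Complex.exp (w i ^ 2 / 2) := by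
    simpa [complexMGF] using complexMGF_id_gaussianReal (μ := 0) (v := 1) (w i)
  simp_rw [Complex.exp_sum, ← h]
  exact integral_fintype_prod_eq_prod (fun i (x : ℝ) => Complex.exp (w i * x))

theorem integral_cexp_isoGaussian (b : 𝓔) {v : ℝ} (hv : 0 ≤ v) (w : Fin d → ℂ) :
    ∫ x, Complex.exp (∑ i, w i * x i) ∂(isoGaussian b v)
      = Complex.exp (∑ i, (w i * b i + v * w i ^ 2 / 2)) := by
  rw [isoGaussian, integral_map (by fun_prop) (by fun_prop)]
  have h (z : 𝓔) : Complex.exp (∑ i, w i * (b + Real.sqrt v • z) i)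
      = Complex.exp (∑ i, w i * b i) * Complex.exp (∑ i, (w i * Real.sqrt v) * z i) := by
    rw [← Complex.exp_add, ← Finset.sum_add_distrib]
    congr 1
    refine Finset.sum_congr rfl fun i _ => ?_
    simp
    ring
  have hs : (Real.sqrt v : ℂ) ^ 2 = v := by
    rw [← Complex.ofReal_pow, Real.sq_sqrt hv]
  simp_rw [h]
  rw [integral_const_mul, integral_cexp_stdGaussian, ← Complex.exp_add,
    ← Finset.sum_add_distrib]
  congr 1
  refine Finset.sum_congr rfl fun i _ => ?_
  rw [mul_pow, hs]
  ring

theorem integral_exp_inner_isoGaussian (b h : 𝓔) {v : ℝ} (hv : 0 ≤ v) :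
    ∫ x, Real.exp (inner ℝ h x) ∂(isoGaussian b v)
      = Real.exp (inner ℝ h b + v * ‖h‖ ^ 2 / 2) := by
  have key := integral_cexp_isoGaussian b hv (fun i => (h i : ℂ))
  apply Complex.ofReal_injective
  rw [← integral_complex_ofReal]
  convert key using 1
  · congr 1 with x
    push_cast
    simp [PiLp.inner_apply, mul_comm]
  · simp [PiLp.inner_apply, EuclideanSpace.real_norm_sq_eq, Finset.sum_add_distrib,
      Finset.mul_sum, Finset.sum_div, mul_comm]

theorem integrable_exp_inner_isoGaussian (b h : 𝓔) {v : ℝ} (hv : 0 ≤ v) :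
    Integrable (fun x => Real.exp (inner ℝ h x)) (isoGaussian b v) :=
  Integrable.of_integral_ne_zero <| by
    rw [integral_exp_inner_isoGaussian b h hv]
    exact (Real.exp_pos _).ne'

theorem charFun_isoGaussian (b t : 𝓔) {v : ℝ} (hv : 0 ≤ v) :
    charFun (isoGaussian b v) t
      = Complex.exp (inner ℝ b t * Complex.I - v * ‖t‖ ^ 2 / 2) := by
  have key := integral_cexp_isoGaussian b hv (fun i => (t i : ℂ) * Complex.I)
  rw [charFun_apply]
  convert key using 1
  · congr 1 with x
    simp [PiLp.inner_apply, Finset.sum_mul, mul_right_comm]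
  · congr 1
    simp_rw [← Complex.ofReal_pow, EuclideanSpace.real_norm_sq_eq, PiLp.inner_apply]
    push_cast
    rw [Finset.sum_mul, Finset.mul_sum, Finset.sum_div, ← Finset.sum_sub_distrib]
    refine Finset.sum_congr rfl fun i _ => ?_
    simp [mul_pow]
    ring

theorem isoGaussian_zero_zero : isoGaussian (0 : 𝓔) 0 = Measure.dirac 0 := by
  apply Measure.ext_of_charFun
  ext t
  simp [charFun_isoGaussian, charFun_dirac]

/-- An affine autoregressive step with Gaussian noise maps Gaussians to Gaussians. -/
theorem map_prod_isoGaussian (b b' : 𝓔) {v : ℝ} (hv : 0 ≤ v) (r : ℝ) {w : ℝ} (hw : 0 ≤ w) :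
    Measure.map (fun q : 𝓔 × 𝓔 => r • q.1 + b' + Real.sqrt w • q.2)
      ((isoGaussian b v).prod (stdGaussian d)) = isoGaussian (r • b + b') (r ^ 2 * v + w) := by
  have h : Measure.map (fun q : 𝓔 × 𝓔 => r • q.1 + b' + Real.sqrt w • q.2)
      ((isoGaussian b v).prod (stdGaussian d))
      = ((isoGaussian b v).map (r • ·)) ∗ (isoGaussian b' w) := by
    rw [isoGaussian.eq_def b', Measure.conv, Measure.map_prod_map _ _ (by fun_prop) (by fun_prop),
      Measure.map_map (by fun_prop) (by fun_prop)]
    congr 1 with q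
    simp [add_assoc]
  have : IsProbabilityMeasure ((isoGaussian b v).map (r • ·)) :=
    Measure.isProbabilityMeasure_map (by fun_prop)
  rw [h]
  apply Measure.ext_of_charFun
  ext t
  rw [charFun_conv, charFun_map_smul, charFun_isoGaussian _ _ hv, charFun_isoGaussian _ _ hw,
    charFun_isoGaussian _ _ (by positivity), ← Complex.exp_add]
  congr 1
  simp only [inner_add_left, real_inner_smul_left, real_inner_smul_right, norm_smul,
    Real.norm_eq_abs]
  push_cast
  rw [mul_pow, ← Complex.ofReal_pow |r|, sq_abs]
  push_cast
  ring

/-- The law of the linear Gaussian recursion `θ ↦ r θ + b + √w Z` started at the origin. -/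
theorem gaussian_recursion_law (r : ℝ) (b : 𝓔) {w : ℝ} (hw : 0 ≤ w) (μ : ℕ → Measure 𝓔)
    (hμ0 : μ 0 = Measure.dirac 0)
    (hrec : ∀ k : ℕ, μ (k + 1) = Measure.map
      (fun q : 𝓔 × 𝓔 => r • q.1 + b + Real.sqrt w • q.2) ((μ k).prod (stdGaussian d))) (k : ℕ) :
    μ k = isoGaussian ((∑ i ∈ Finset.range k, r ^ i) • b)
      (w * ∑ i ∈ Finset.range k, r ^ (2 * i)) := by
  induction k with
  | zero => simp [hμ0, isoGaussian_zero_zero]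
  | succ k ih =>
    have hv : 0 ≤ w * ∑ i ∈ Finset.range k, r ^ (2 * i) :=
      mul_nonneg hw (Finset.sum_nonneg fun i _ => (even_two_mul i).pow_nonneg r)
    rw [hrec, ih, map_prod_isoGaussian _ _ hv _ hw]
    congr 1
    · rw [geom_sum_succ, add_smul, mul_smul, one_smul]
    · simp_rw [pow_mul]
      rw [geom_sum_succ]
      ring

theorem isoGaussian_tilted (b h : 𝓔) {v : ℝ} (hv : 0 ≤ v) :
    (isoGaussian b v).tilted (fun x => inner ℝ h x) = isoGaussian (b + v • h) v := by
  have := isProbabilityMeasure_tilted (integrable_exp_inner_isoGaussian b h hv)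
  apply Measure.ext_of_charFun
  ext t
  rw [charFun_apply, integral_tilted, integral_exp_inner_isoGaussian b h hv,
    charFun_isoGaussian _ _ hv]
  have key := integral_cexp_isoGaussian b hv (fun i => (h i : ℂ) + t i * Complex.I)
  have hx (x : 𝓔) : (Real.exp (inner ℝ h x) / Real.exp (inner ℝ h b + v * ‖h‖ ^ 2 / 2)) •
      Complex.exp (inner ℝ x t * Complex.I)
      = Complex.exp (-(inner ℝ h b + v * ‖h‖ ^ 2 / 2 : ℝ)) *
        Complex.exp (∑ i, ((h i : ℂ) + t i * Complex.I) * x i) := by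
    rw [← Real.exp_sub, Complex.real_smul, Complex.ofReal_exp, ← Complex.exp_add,
      ← Complex.exp_add]
    congr 1
    have : ∑ i, ((h i : ℂ) + t i * Complex.I) * x i
        = (inner ℝ h x : ℝ) + (inner ℝ x t : ℝ) * Complex.I := by
      simp only [PiLp.inner_apply]
      push_cast
      rw [Finset.sum_mul, ← Finset.sum_add_distrib]
      refine Finset.sum_congr rfl fun i _ => ?_
      simp
      ring
    rw [this]
    push_cast
    ring
  simp_rw [hx]
  rw [integral_const_mul, key, ← Complex.exp_add]
  congr 1
  simp only [inner_add_left, real_inner_smul_left]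
  simp_rw [← Complex.ofReal_pow, EuclideanSpace.real_norm_sq_eq, PiLp.inner_apply]
  push_cast
  simp only [Finset.mul_sum, Finset.sum_mul, Finset.sum_div, ← Finset.sum_sub_distrib,
    ← Finset.sum_add_distrib, ← Finset.sum_neg_distrib]
  refine Finset.sum_congr rfl fun i _ => ?_
  simp
  linear_combination (v * (t i : ℂ) ^ 2 / 2) * Complex.I_sq

/-- The Rényi divergence between two isotropic Gaussians with the same variance. -/
theorem renyiDiv_isoGaussian (b b' : 𝓔) {v : ℝ} (hv : 0 < v) {α : ℝ} (hα : 1 < α) :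
    renyiDiv α (isoGaussian b v) (isoGaussian b' v) = α * ‖b - b'‖ ^ 2 / (2 * v) := by
  obtain ⟨h, hh⟩ : ∃ h : 𝓔, h = v⁻¹ • (b - b') := ⟨_, rfl⟩
  have hb : isoGaussian b v = (isoGaussian b' v).tilted (fun x => inner ℝ h x) := by
    rw [isoGaussian_tilted b' h hv.le, hh, smul_inv_smul₀ hv.ne', add_sub_cancel]
  have hint : ∫ x, ((isoGaussian b v).rnDeriv (isoGaussian b' v) x).toReal ^ α ∂(isoGaussian b' v)
      = Real.exp ((α ^ 2 - α) * (v * ‖h‖ ^ 2 / 2)) := by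
    have hae : (fun x => ((isoGaussian b v).rnDeriv (isoGaussian b' v) x).toReal ^ α)
        =ᵐ[isoGaussian b' v] fun x => Real.exp (-(α * (inner ℝ h b' + v * ‖h‖ ^ 2 / 2))) *
          Real.exp (inner ℝ (α • h) x) := by
      rw [hb]
      filter_upwards [rnDeriv_tilted_left_self (μ := isoGaussian b' v)
        (f := fun x => inner ℝ h x) (by fun_prop)] with x hx
      rw [hx, integral_exp_inner_isoGaussian b' h hv.le, ENNReal.toReal_ofReal (by positivity),
        ← Real.exp_sub, ← Real.exp_mul, ← Real.exp_add, real_inner_smul_left]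
      congr 1
      ring
    rw [integral_congr_ae hae, integral_const_mul, integral_exp_inner_isoGaussian _ _ hv.le,
      ← Real.exp_add, real_inner_smul_left, norm_smul, mul_pow, Real.norm_eq_abs, sq_abs]
    congr 1
    ring
  have hα' : α - 1 ≠ 0 := by linarith
  rw [renyiDiv, hint, Real.log_exp, hh, norm_smul, mul_pow, Real.norm_eq_abs, sq_abs]
  field_simp

/-- explicit Gaussian law of the linear noisy GD recursion and the exact
Rényi divergence between the two chains. -/
theorem gaussian_chain_law_and_exact_renyi
    (η σt : ℝ) (hη : 0 < η) (hη1 : η < 1) (hσt : 0 < σt)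
    (m m' : 𝓔) (K : ℕ) (hK : 1 ≤ K)
    (μ μ' : ℕ → Measure 𝓔)
    (hμ0 : μ 0 = Measure.dirac 0) (hμ'0 : μ' 0 = Measure.dirac 0)
    (hrec : ∀ k : ℕ, μ (k + 1) = Measure.map
      (fun q : 𝓔 × 𝓔 => (1 - η) • q.1 + η • m + Real.sqrt (2 * η * σt ^ 2) • q.2)
      ((μ k).prod (stdGaussian d)))
    (hrec' : ∀ k : ℕ, μ' (k + 1) = Measure.map
      (fun q : 𝓔 × 𝓔 => (1 - η) • q.1 + η • m' + Real.sqrt (2 * η * σt ^ 2) • q.2)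
      ((μ' k).prod (stdGaussian d))) :
    (μ K = Measure.map
      (fun z : 𝓔 => (η * ∑ i ∈ Finset.range K, (1 - η) ^ i) • m
        + Real.sqrt (2 * η * σt ^ 2 * ∑ i ∈ Finset.range K, (1 - η) ^ (2 * i)) • z)
      (stdGaussian d))
    ∧ (μ' K = Measure.map
      (fun z : 𝓔 => (η * ∑ i ∈ Finset.range K, (1 - η) ^ i) • m'
        + Real.sqrt (2 * η * σt ^ 2 * ∑ i ∈ Finset.range K, (1 - η) ^ (2 * i)) • z)
      (stdGaussian d))
    ∧ ∀ α > (1:ℝ),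
      renyiDiv α (μ K) (μ' K)
        = α * ‖m - m'‖ ^ 2 / (4 * σt ^ 2) * ((2 - η) / (1 + (1 - η) ^ K))
            * (1 - (1 - η) ^ K) := by
  have hw : 0 ≤ 2 * η * σt ^ 2 := by positivity
  have law {b : 𝓔} {ν : ℕ → Measure 𝓔} (h0 : ν 0 = Measure.dirac 0)
      (h : ∀ k : ℕ, ν (k + 1) = Measure.map
        (fun q : 𝓔 × 𝓔 => (1 - η) • q.1 + η • b + Real.sqrt (2 * η * σt ^ 2) • q.2)
        ((ν k).prod (stdGaussian d))) :
      ν K = isoGaussian ((η * ∑ i ∈ Finset.range K, (1 - η) ^ i) • b)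
        (2 * η * σt ^ 2 * ∑ i ∈ Finset.range K, (1 - η) ^ (2 * i)) := by
    rw [gaussian_recursion_law (1 - η) (η • b) hw ν h0 h K, smul_smul, mul_comm η]
  refine ⟨law hμ0 hrec, law hμ'0 hrec', fun α hα => ?_⟩
  have h2 : 0 < 2 - η := by linarith
  have hr0 : 0 < 1 - η := by linarith
  have hr : (1 - η) ^ K < 1 := pow_lt_one₀ hr0.le (by linarith) (by omega)
  have hrK : 0 < (1 - η) ^ K := pow_pos hr0 K
  have hS1 : η * ∑ i ∈ Finset.range K, (1 - η) ^ i = 1 - (1 - η) ^ K := by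
    have := mul_neg_geom_sum (1 - η) K
    rwa [sub_sub_cancel] at this
  have hS2 : ∑ i ∈ Finset.range K, (1 - η) ^ (2 * i)
      = (1 - (1 - η) ^ K) * (1 + (1 - η) ^ K) / (η * (2 - η)) := by
    have := mul_neg_geom_sum ((1 - η) ^ 2) K
    simp_rw [← pow_mul] at this
    rw [eq_div_iff (by positivity)]
    rw [mul_comm 2 K, pow_mul] at this
    linear_combination this
  have h1K : 0 < 1 - (1 - η) ^ K := by linarith
  rw [law hμ0 hrec, law hμ'0 hrec', hS1, hS2, renyiDiv_isoGaussian _ _ (by positivity) hα,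
    ← smul_sub, norm_smul, mul_pow, Real.norm_eq_abs, sq_abs]
  field_simp
  ring

end
end
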